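/- arXiv:2503.03754 — 8 statements merged into one kernel-verified Lean document; each statement's English description precedes it below -/
import Mathlib

section
/- Let Φ ∈ 𝓕 with domain I, let X and Y be independent finite-valued random variables, and let f be a function of (X,Y) with values in I. Then H_Φ(f|X) ≥ H_Φ(E[f|Y]); equivalently, E[Φ(f)] − E_X[Φ(E[f|X])] ≥ E_Y[Φ(E[f|Y])] − Φ(E[f]). -/
open Finset

/-- A probability mass function on a finite sample space. -/
def IsPMF {Ω : Type*} [Fintype Ω] (p : Ω → ℝ) : Prop :=
  (∀ ω, 0 ≤ p ω) ∧ ∑ ω, p ω = 1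

/-- Expectation of `f` with respect to the mass function `p`. -/
noncomputable def pexp {Ω : Type*} [Fintype Ω] (p f : Ω → ℝ) : ℝ :=
  ∑ ω, p ω * f ω

/-- Conditional expectation `E[f | X]`, as a random variable on `Ω`. -/
noncomputable def pcexp {Ω α : Type*} [Fintype Ω] [DecidableEq α]
    (p : Ω → ℝ) (X : Ω → α) (f : Ω → ℝ) (ω : Ω) : ℝ :=
  (∑ ω', if X ω' = X ω then p ω' * f ω' else 0) /
    (∑ ω', if X ω' = X ω then p ω' else 0)

/-- The Φ-entropy `H_Φ(f) = E[Φ(f)] - Φ(E[f])`. -/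
noncomputable def entPhi {Ω : Type*} [Fintype Ω] (Φ : ℝ → ℝ) (p f : Ω → ℝ) : ℝ :=
  pexp p (fun ω => Φ (f ω)) - Φ (pexp p f)

/-- The conditional Φ-entropy `H_Φ(f | X) = E[Φ(f)] - E[Φ(E[f|X])]`. -/
noncomputable def condEntPhi {Ω α : Type*} [Fintype Ω] [DecidableEq α]
    (Φ : ℝ → ℝ) (p : Ω → ℝ) (f : Ω → ℝ) (X : Ω → α) : ℝ :=
  pexp p (fun ω => Φ (f ω)) - pexp p (fun ω => Φ (pcexp p X f ω))

/-- The class `𝓕` of non-affine smooth convex functions `Φ` on a convex set `I ⊆ ℝ`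
with `Φ'' > 0` such that `1/Φ''` is concave on `I`. -/
structure PhiFamily where
  Φ : ℝ → ℝ
  I : Set ℝ
  convex_I : Convex ℝ I
  smooth : ContDiffOn ℝ (⊤ : ℕ∞) Φ I
  convexOn : ConvexOn ℝ I Φ
  nonaffine : ¬ ∃ c₁ c₀ : ℝ, ∀ x ∈ I, Φ x = c₁ * x + c₀
  secondDeriv_pos : ∀ x ∈ I, 0 < iteratedDerivWithin 2 Φ I x
  inv_secondDeriv_concave : ConcaveOn ℝ I (fun x => 1 / iteratedDerivWithin 2 Φ I x)

/-- The Φ-ribbon of a joint distribution `μ` on `α × β`: all pairs `(λ₁, λ₂)` with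
`λ₁ H_Φ(E[f|A]) + λ₂ H_Φ(E[f|B]) ≤ H_Φ(f)` for every `I`-valued function `f` of `(A,B)`. -/
def ribbon {α β : Type*} [Fintype α] [Fintype β] [DecidableEq α] [DecidableEq β]
    (P : PhiFamily) (μ : α × β → ℝ) : Set (ℝ × ℝ) :=
  {l : ℝ × ℝ | ∀ f : α × β → ℝ, (∀ ab, f ab ∈ P.I) →
    l.1 * entPhi P.Φ μ (pcexp μ Prod.fst f) +
      l.2 * entPhi P.Φ μ (pcexp μ Prod.snd f) ≤ entPhi P.Φ μ f}

theorem PhiFamily.uniqueDiffOn (P : PhiFamily) : UniqueDiffOn ℝ P.I := by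
  refine uniqueDiffOn_convex P.convex_I (P.convex_I.nontrivial_iff_nonempty_interior.1 ?_)
  by_contra h
  rw [Set.not_nontrivial_iff] at h
  apply P.nonaffine
  rcases h.eq_empty_or_singleton with h | ⟨x, h⟩
  · exact ⟨0, 0, by simp [h]⟩
  · exact ⟨0, P.Φ x, by simp [h]⟩

theorem PhiFamily.hasDerivWithinAt_iteratedDerivWithin (P : PhiFamily) (n : ℕ) {x : ℝ}
    (hx : x ∈ P.I) :
    HasDerivWithinAt (iteratedDerivWithin n P.Φ P.I)
      (iteratedDerivWithin (n + 1) P.Φ P.I x) P.I x := by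
  rw [iteratedDerivWithin_succ]
  exact (P.smooth.differentiableOn_iteratedDerivWithin (mod_cast WithTop.coe_lt_top n)
    P.uniqueDiffOn x hx).hasDerivWithinAt

theorem PhiFamily.sum_mem (P : PhiFamily) {α : Type*} [Fintype α] {q : α → ℝ} (hq : IsPMF q)
    {t : α → ℝ} (ht : ∀ a, t a ∈ P.I) : ∑ a, q a * t a ∈ P.I := by
  simpa using P.convex_I.sum_mem (fun a _ => hq.1 a) hq.2 (fun a _ => ht a)

/-- The second variation of the Φ-entropy is nonnegative. -/
theorem PhiFamily.secondDeriv_mul_sum_sq_le (P : PhiFamily) {α : Type*} [Fintype α] {q : α → ℝ}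
    (hq : IsPMF q) {t : α → ℝ} (ht : ∀ a, t a ∈ P.I) (d : α → ℝ) :
    iteratedDerivWithin 2 P.Φ P.I (∑ a, q a * t a) * (∑ a, q a * d a) ^ 2 ≤
      ∑ a, q a * (iteratedDerivWithin 2 P.Φ P.I (t a) * d a ^ 2) := by
  have hm := P.secondDeriv_pos _ (P.sum_mem hq ht)
  have hpos := fun a => P.secondDeriv_pos _ (ht a)
  have hinv := P.inv_secondDeriv_concave.le_map_sum (fun a _ => hq.1 a) hq.2 (fun a _ => ht a)
  simp only [smul_eq_mul] at hinv
  have hnonneg : ∀ a, 0 ≤ q a * (iteratedDerivWithin 2 P.Φ P.I (t a) * d a ^ 2) := fun a =>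
    mul_nonneg (hq.1 a) (mul_nonneg (hpos a).le (sq_nonneg _))
  have hcs := sum_sq_le_sum_mul_sum_of_sq_le_mul univ (r := fun a => q a * d a)
    (fun a _ => hnonneg a)
    (fun a _ => mul_nonneg (hq.1 a) (one_div_pos.2 (hpos a)).le)
    (fun a _ => by
      have := (hpos a).ne'
      apply le_of_eq
      field_simp)
  have := hcs.trans (mul_le_mul_of_nonneg_left hinv (sum_nonneg fun a _ => hnonneg a))
  rw [mul_one_div, le_div_iff₀ hm] at this
  linarith

/-- For a fixed mass function, the Φ-entropy is a convex functional of the random variable. -/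
theorem PhiFamily.convexOn_entPhi (P : PhiFamily) {α : Type*} [Fintype α] {q : α → ℝ}
    (hq : IsPMF q) : ConvexOn ℝ {t : α → ℝ | ∀ a, t a ∈ P.I} (entPhi P.Φ q) := by
  have hconv : Convex ℝ {t : α → ℝ | ∀ a, t a ∈ P.I} := fun t ht u hu a b ha hb hab i =>
    P.convex_I (ht i) (hu i) ha hb hab
  refine ⟨hconv, fun t ht u hu a b ha hb hab => ?_⟩
  have hline : ∀ s ∈ Set.Icc (0 : ℝ) 1, ∀ i, t i + s * (u i - t i) ∈ P.I := fun s hs i => by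
    have := P.convex_I (ht i) (hu i) (sub_nonneg.2 hs.2) hs.1 (sub_add_cancel 1 s)
    convert this using 1
    simp only [smul_eq_mul]
    ring
  have hderiv : ∀ (n : ℕ) (c d : ℝ) (S : Set ℝ), (∀ s ∈ S, c + s * d ∈ P.I) → ∀ s ∈ S,
      HasDerivWithinAt (fun s => iteratedDerivWithin n P.Φ P.I (c + s * d))
        (iteratedDerivWithin (n + 1) P.Φ P.I (c + s * d) * d) S s := fun n c d S hS s hs =>
    HasDerivWithinAt.comp (h₂ := iteratedDerivWithin n P.Φ P.I) (h := fun s => c + s * d) s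
      (P.hasDerivWithinAt_iteratedDerivWithin n (hS s hs))
      (((hasDerivAt_id s).mul_const d).const_add c |>.congr_deriv (one_mul d)).hasDerivWithinAt hS
  set m := ∑ i, q i * t i with hm_def
  set e := ∑ i, q i * (u i - t i) with he_def
  have hmean : ∀ s, ∑ i, q i * (t i + s * (u i - t i)) = m + s * e := fun s => by
    rw [hm_def, he_def, mul_sum, ← sum_add_distrib]
    exact sum_congr rfl fun i _ => by ring
  have hmem : ∀ s ∈ Set.Icc (0 : ℝ) 1, m + s * e ∈ P.I := fun s hs => by
    rw [← hmean]
    exact P.sum_mem hq (hline s hs)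
  have hent : ∀ s, entPhi P.Φ q (fun i => t i + s * (u i - t i)) =
      ∑ i, q i * P.Φ (t i + s * (u i - t i)) - P.Φ (m + s * e) := fun s => by
    simp only [entPhi, pexp, hmean]
  have hg0 : ∀ s ∈ Set.Icc (0 : ℝ) 1, HasDerivWithinAt
      (fun s => entPhi P.Φ q (fun i => t i + s * (u i - t i)))
      (∑ i, q i * (iteratedDerivWithin 1 P.Φ P.I (t i + s * (u i - t i)) * (u i - t i)) -
        iteratedDerivWithin 1 P.Φ P.I (m + s * e) * e) (Set.Icc 0 1) s := fun s hs => by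
    simp only [hent]
    have h := hderiv 0
    simp only [iteratedDerivWithin_zero] at h
    exact (HasDerivWithinAt.fun_sum fun i _ => (h _ _ _ (fun s hs => hline s hs i) s hs).const_mul
      (q i)).sub (h _ _ _ hmem s hs)
  have hg1 : ∀ s ∈ Set.Icc (0 : ℝ) 1, HasDerivWithinAt
      (fun s => ∑ i, q i * (iteratedDerivWithin 1 P.Φ P.I (t i + s * (u i - t i)) * (u i - t i)) -
        iteratedDerivWithin 1 P.Φ P.I (m + s * e) * e)
      (∑ i, q i * (iteratedDerivWithin 2 P.Φ P.I (t i + s * (u i - t i)) * (u i - t i) *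
        (u i - t i)) - iteratedDerivWithin 2 P.Φ P.I (m + s * e) * e * e) (Set.Icc 0 1) s :=
    fun s hs => (HasDerivWithinAt.fun_sum fun i _ =>
      ((hderiv 1 _ _ _ (fun s hs => hline s hs i) s hs).mul_const _).const_mul (q i)).sub
        ((hderiv 1 _ _ _ hmem s hs).mul_const e)
  have hg : ConvexOn ℝ (Set.Icc (0 : ℝ) 1)
      (fun s => entPhi P.Φ q (fun i => t i + s * (u i - t i))) := by
    refine convexOn_of_hasDerivWithinAt2_nonneg (convex_Icc 0 1)
      (fun s hs => (hg0 s hs).continuousWithinAt)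
      (fun s hs => (hg0 s (interior_subset hs)).mono interior_subset)
      (fun s hs => (hg1 s (interior_subset hs)).mono interior_subset) fun s hs => ?_
    have h := P.secondDeriv_mul_sum_sq_le hq (hline s (interior_subset hs)) (fun i => u i - t i)
    rw [hmean] at h
    simpa only [sub_nonneg, mul_assoc, ← sq] using h
  have h := hg.2 (Set.left_mem_Icc.2 zero_le_one) (Set.right_mem_Icc.2 zero_le_one) ha hb hab
  have hpt : a • t + b • u = fun i => t i + b * (u i - t i) := by
    funext i
    simp only [Pi.add_apply, Pi.smul_apply, smul_eq_mul]
    linear_combination t i * hab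
  rw [hpt]
  simpa using h

theorem pcexp_fst {α β : Type*} [Fintype α] [Fintype β] [DecidableEq α]
    {p : α → ℝ} {q : β → ℝ} (hq : IsPMF q) (f : α × β → ℝ) {a : α} (ha : p a ≠ 0) (b : β) :
    pcexp (fun ab : α × β => p ab.1 * q ab.2) Prod.fst f (a, b) = ∑ b, q b * f (a, b) := by
  have hnum : ∑ ab : α × β, (if ab.1 = a then p ab.1 * q ab.2 * f ab else 0) =
      p a * ∑ b, q b * f (a, b) := by
    rw [Fintype.sum_prod_type, sum_eq_single a (fun a' _ h => by simp [h]) (by simp)]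
    simp [mul_sum, mul_assoc]
  have hden : ∑ ab : α × β, (if ab.1 = a then p ab.1 * q ab.2 else 0) = p a := by
    rw [Fintype.sum_prod_type, sum_eq_single a (fun a' _ h => by simp [h]) (by simp)]
    simp [← mul_sum, hq.2]
  change (∑ ab : α × β, (if ab.1 = a then p ab.1 * q ab.2 * f ab else 0)) /
    (∑ ab : α × β, (if ab.1 = a then p ab.1 * q ab.2 else 0)) = _
  rw [hnum, hden, mul_div_cancel_left₀ _ ha]

theorem pexp_comp_pcexp_fst {α β : Type*} [Fintype α] [Fintype β] [DecidableEq α]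
    (p : α → ℝ) {q : β → ℝ} (hq : IsPMF q) (f : α × β → ℝ) (φ : ℝ → ℝ) :
    pexp (fun ab : α × β => p ab.1 * q ab.2)
        (fun ab => φ (pcexp (fun ab : α × β => p ab.1 * q ab.2) Prod.fst f ab)) =
      ∑ a, p a * φ (∑ b, q b * f (a, b)) := by
  simp only [pexp, Fintype.sum_prod_type]
  refine sum_congr rfl fun a _ => ?_
  by_cases ha : p a = 0
  · simp [ha]
  · simp only [pcexp_fst hq f ha, ← sum_mul, ← mul_sum, hq.2, mul_one]

theorem pexp_comp_pcexp_snd {α β : Type*} [Fintype α] [Fintype β] [DecidableEq β]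
    {p : α → ℝ} (hp : IsPMF p) (q : β → ℝ) (f : α × β → ℝ) (φ : ℝ → ℝ) :
    pexp (fun ab : α × β => p ab.1 * q ab.2)
        (fun ab => φ (pcexp (fun ab : α × β => p ab.1 * q ab.2) Prod.snd f ab)) =
      ∑ b, q b * φ (∑ a, p a * f (a, b)) := by
  refine Eq.trans ?_ (pexp_comp_pcexp_fst q hp (fun ba => f ba.swap) φ)
  simp only [pexp, pcexp]
  refine Fintype.sum_equiv (Equiv.prodComm α β) _ _ fun ab => ?_
  refine congrArg₂ _ (mul_comm _ _) (congrArg φ (congrArg₂ _ ?_ ?_))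
  all_goals
    refine Fintype.sum_equiv (Equiv.prodComm α β) _ _ fun ab' => ?_
    simp [mul_comm (q _)]

/-- for `Φ ∈ 𝓕`, independent `X`, `Y` and any `I`-valued function `f` of
`(X,Y)`, we have `H_Φ(f|X) ≥ H_Φ(E[f|Y])`, i.e.
`E[Φ(f)] − E_X[Φ(E[f|X])] ≥ E_Y[Φ(E[f|Y])] − Φ(E[f])`. -/
theorem stmt2 (P : PhiFamily)
    {α β : Type*} [Fintype α] [Fintype β] [DecidableEq α] [DecidableEq β]
    (pX : α → ℝ) (pY : β → ℝ) (hX : IsPMF pX) (hY : IsPMF pY)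
    (f : α × β → ℝ) (hf : ∀ ab, f ab ∈ P.I) :
    condEntPhi P.Φ (fun ab : α × β => pX ab.1 * pY ab.2) f Prod.fst ≥
      entPhi P.Φ (fun ab : α × β => pX ab.1 * pY ab.2)
        (pcexp (fun ab : α × β => pX ab.1 * pY ab.2) Prod.snd f) ∧
    pexp (fun ab : α × β => pX ab.1 * pY ab.2) (fun ab => P.Φ (f ab)) -
        pexp (fun ab : α × β => pX ab.1 * pY ab.2)
          (fun ab => P.Φ (pcexp (fun ab : α × β => pX ab.1 * pY ab.2) Prod.fst f ab)) ≥
      pexp (fun ab : α × β => pX ab.1 * pY ab.2)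
          (fun ab => P.Φ (pcexp (fun ab : α × β => pX ab.1 * pY ab.2) Prod.snd f ab)) -
        P.Φ (pexp (fun ab : α × β => pX ab.1 * pY ab.2) f) := by
  set μ : α × β → ℝ := fun ab => pX ab.1 * pY ab.2 with hμ
  have hfst := pexp_comp_pcexp_fst pX hY f P.Φ
  have hsnd := pexp_comp_pcexp_snd hX pY f P.Φ
  have hf_mean : pexp μ f = ∑ a, pX a * ∑ b, pY b * f (a, b) := by
    simp only [pexp, hμ, Fintype.sum_prod_type, mul_sum, mul_assoc]
  have hΦf_mean : pexp μ (fun ab => P.Φ (f ab)) = ∑ b, pY b * ∑ a, pX a * P.Φ (f (a, b)) := by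
    simp only [pexp, hμ, Fintype.sum_prod_type_right, mul_sum]
    exact sum_congr rfl fun b _ => sum_congr rfl fun a _ => by ring
  have htower : pexp μ (pcexp μ Prod.snd f) = pexp μ f := by
    have h := pexp_comp_pcexp_snd hX pY f id
    simp only [id] at h
    rw [h, pexp, Fintype.sum_prod_type_right]
    simp only [hμ, mul_sum]
    exact sum_congr rfl fun b _ => sum_congr rfl fun a _ => by ring
  have hjensen := (P.convexOn_entPhi hX).map_sum_le (fun b _ => hY.1 b) hY.2
    (fun b _ a => hf (a, b) : ∀ b ∈ univ, (fun a => f (a, b)) ∈ {t : α → ℝ | ∀ a, t a ∈ P.I})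
  simp only [entPhi, pexp, Finset.sum_apply, Pi.smul_apply, smul_eq_mul, mul_sub,
    sum_sub_distrib] at hjensen
  have hmain : pexp μ (fun ab => P.Φ (f ab)) - pexp μ (fun ab => P.Φ (pcexp μ Prod.fst f ab)) ≥
      pexp μ (fun ab => P.Φ (pcexp μ Prod.snd f ab)) - P.Φ (pexp μ f) := by
    rw [hfst, hsnd, hf_mean, hΦf_mean]
    linarith
  refine ⟨?_, hmain⟩
  rw [condEntPhi, entPhi, htower]
  exact hmain
end

section
/- Let Φ ∈ 𝓕 with domain I, let (X,Z,Y) be finite-valued random variables forming a Markov chain X → Z → Y (X and Y are conditionally independent given Z), and let f be a function of (X,Y,Z) with values in I. Then H_Φ(f | X,Z) ≥ H_Φ(E[f | Y,Z] | Z). -/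
open Finset

namespace PhiFamily

variable (P : PhiFamily)

theorem exists_lt_mem : ∃ a ∈ P.I, ∃ b ∈ P.I, a < b := by
  by_contra! h
  refine P.nonaffine ?_
  rcases P.I.eq_empty_or_nonempty with hI | ⟨a, ha⟩
  · exact ⟨0, 0, by simp [hI]⟩
  · refine ⟨0, P.Φ a, fun x hx => ?_⟩
    rw [le_antisymm (h a ha x hx) (h x hx a ha)]
    ring

theorem uniqueDiffOn_s3 : UniqueDiffOn ℝ P.I := by
  obtain ⟨a, ha, b, hb, hab⟩ := P.exists_lt_mem
  refine uniqueDiffOn_convex P.convex_I ?_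
  have hsub : Set.Ioo a b ⊆ interior P.I :=
    interior_maximal (Set.Ioo_subset_Icc_self.trans (P.convex_I.ordConnected.out ha hb))
      isOpen_Ioo
  exact (Set.nonempty_Ioo.2 hab).mono hsub

theorem hasDerivWithinAt {x : ℝ} (hx : x ∈ P.I) :
    HasDerivWithinAt P.Φ (derivWithin P.Φ P.I x) P.I x :=
  (P.smooth.differentiableOn (by simp) x hx).hasDerivWithinAt

theorem hasDerivWithinAt_derivWithin {x : ℝ} (hx : x ∈ P.I) :
    HasDerivWithinAt (derivWithin P.Φ P.I) (iteratedDerivWithin 2 P.Φ P.I x) P.I x := by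
  have h := (P.smooth.differentiableOn_iteratedDerivWithin (m := 1)
    (by exact_mod_cast WithTop.coe_lt_top _) P.uniqueDiffOn_s3 x hx).hasDerivWithinAt
  rw [← iteratedDerivWithin_succ, iteratedDerivWithin_one] at h
  exact h

variable {β : Type*} [Fintype β]

theorem secondDeriv_mul_sq_sum_le {q g h : β → ℝ} (hq : ∀ y, 0 ≤ q y) (hq1 : ∑ y, q y = 1)
    (hg : ∀ y, g y ∈ P.I) :
    iteratedDerivWithin 2 P.Φ P.I (∑ y, q y * g y) * (∑ y, q y * h y) ^ 2 ≤
      ∑ y, q y * (iteratedDerivWithin 2 P.Φ P.I (g y) * h y ^ 2) := by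
  set d := iteratedDerivWithin 2 P.Φ P.I with hd
  have hmem : ∑ y, q y * g y ∈ P.I := by
    simpa using P.convex_I.sum_mem (fun y _ => hq y) hq1 (fun y _ => hg y)
  have hpos : 0 < d (∑ y, q y * g y) := P.secondDeriv_pos _ hmem
  have hconc : ∑ y, q y * (1 / d (g y)) ≤ 1 / d (∑ y, q y * g y) := by
    simpa only [smul_eq_mul] using
      P.inv_secondDeriv_concave.le_map_sum (fun y _ => hq y) hq1 (fun y _ => hg y)
  have hdg : ∀ y, 0 < d (g y) := fun y => P.secondDeriv_pos _ (hg y)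
  have hS : 0 ≤ ∑ y, q y * (d (g y) * h y ^ 2) :=
    sum_nonneg fun y _ => mul_nonneg (hq y) (mul_nonneg (hdg y).le (sq_nonneg _))
  have hcs : (∑ y, q y * h y) ^ 2 ≤
      (∑ y, q y * (1 / d (g y))) * ∑ y, q y * (d (g y) * h y ^ 2) := by
    refine sum_sq_le_sum_mul_sum_of_sq_le_mul _
      (fun y _ => mul_nonneg (hq y) (one_div_pos.2 (hdg y)).le)
      (fun y _ => mul_nonneg (hq y) (mul_nonneg (hdg y).le (sq_nonneg _))) fun y _ => le_of_eq ?_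
    have := (hdg y).ne'
    field_simp
  calc d (∑ y, q y * g y) * (∑ y, q y * h y) ^ 2
      ≤ d (∑ y, q y * g y) * (1 / d (∑ y, q y * g y) * ∑ y, q y * (d (g y) * h y ^ 2)) := by
        gcongr
        exact hcs.trans (mul_le_mul_of_nonneg_right hconc hS)
    _ = ∑ y, q y * (d (g y) * h y ^ 2) := by
        rw [← mul_assoc, mul_one_div_cancel hpos.ne', one_mul]

theorem hasDerivWithinAt_comp_line {φ : ℝ → ℝ} {φ' a h t : ℝ}
    (hφ : HasDerivWithinAt φ φ' P.I (a + t * h)) (h0 : a ∈ P.I) (h1 : a + h ∈ P.I) :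
    HasDerivWithinAt (fun s => φ (a + s * h)) (φ' * h) (interior (Set.Icc 0 1)) t := by
  have hline : HasDerivWithinAt (fun s : ℝ => a + s * h) h (interior (Set.Icc 0 1)) t := by
    simpa using (((hasDerivAt_id t).mul_const h).const_add a).hasDerivWithinAt
  refine hφ.comp t hline fun s hs => ?_
  simpa using P.convex_I.add_smul_mem h0 h1 (interior_subset hs)

theorem convexOn_entPhi_line {q g h : β → ℝ} (hq : ∀ y, 0 ≤ q y) (hq1 : ∑ y, q y = 1)
    (hg : ∀ y, g y ∈ P.I) (hgh : ∀ y, g y + h y ∈ P.I) :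
    ConvexOn ℝ (Set.Icc 0 1) (fun t : ℝ => ∑ y, q y * P.Φ (g y + t * h y) -
      P.Φ (∑ y, q y * g y + t * ∑ y, q y * h y)) := by
  have hmean : ∀ k : β → ℝ, (∀ y, k y ∈ P.I) → ∑ y, q y * k y ∈ P.I := fun k hk => by
    simpa using P.convex_I.sum_mem (fun y _ => hq y) hq1 (fun y _ => hk y)
  have hline : ∀ a b : ℝ, a ∈ P.I → a + b ∈ P.I → ∀ t ∈ Set.Icc (0 : ℝ) 1, a + t * b ∈ P.I :=
    fun a b ha hb t ht => by simpa using P.convex_I.add_smul_mem ha hb ht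
  have hm0 := hmean g hg
  have hm1 : ∑ y, q y * g y + ∑ y, q y * h y ∈ P.I := by
    simpa [mul_add, sum_add_distrib] using hmean _ hgh
  have hcont : ∀ a b : ℝ, a ∈ P.I → a + b ∈ P.I →
      ContinuousOn (fun t : ℝ => P.Φ (a + t * b)) (Set.Icc 0 1) := fun a b ha hb =>
    P.smooth.continuousOn.comp (by fun_prop) (hline a b ha hb)
  refine convexOn_of_hasDerivWithinAt2_nonneg (convex_Icc 0 1)
    (f' := fun t => ∑ y, q y * (derivWithin P.Φ P.I (g y + t * h y) * h y) -
      derivWithin P.Φ P.I (∑ y, q y * g y + t * ∑ y, q y * h y) * ∑ y, q y * h y)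
    (f'' := fun t => ∑ y, q y * (iteratedDerivWithin 2 P.Φ P.I (g y + t * h y) * h y * h y) -
      iteratedDerivWithin 2 P.Φ P.I (∑ y, q y * g y + t * ∑ y, q y * h y) *
        (∑ y, q y * h y) * ∑ y, q y * h y)
    ?_ ?_ ?_ ?_
  · exact (continuousOn_finsetSum _ fun y _ =>
      continuousOn_const.mul (hcont _ _ (hg y) (hgh y))).sub (hcont _ _ hm0 hm1)
  · intro t ht
    have ht' := interior_subset ht
    exact (HasDerivWithinAt.fun_sum fun y _ => (P.hasDerivWithinAt_comp_line
      (P.hasDerivWithinAt (hline _ _ (hg y) (hgh y) t ht')) (hg y) (hgh y)).const_mul (q y)).sub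
      (P.hasDerivWithinAt_comp_line (P.hasDerivWithinAt (hline _ _ hm0 hm1 t ht')) hm0 hm1)
  · intro t ht
    have ht' := interior_subset ht
    exact (HasDerivWithinAt.fun_sum fun y _ => ((P.hasDerivWithinAt_comp_line
      (P.hasDerivWithinAt_derivWithin (hline _ _ (hg y) (hgh y) t ht'))
        (hg y) (hgh y)).mul_const (h y)).const_mul (q y)).sub
      ((P.hasDerivWithinAt_comp_line
        (P.hasDerivWithinAt_derivWithin (hline _ _ hm0 hm1 t ht')) hm0 hm1).mul_const _)
  · intro t ht
    have hle := P.secondDeriv_mul_sq_sum_le (h := h) hq hq1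
      (fun y => hline _ _ (hg y) (hgh y) t (interior_subset ht))
    have hsum : ∑ y, q y * (g y + t * h y) = ∑ y, q y * g y + t * ∑ y, q y * h y := by
      rw [mul_sum, ← sum_add_distrib]
      exact sum_congr rfl fun y _ => by ring
    rw [hsum] at hle
    simp only [sq, ← mul_assoc] at hle ⊢
    exact sub_nonneg.2 hle

theorem convexOn_entPhi_s3 {q : β → ℝ} (hq : IsPMF q) :
    ConvexOn ℝ {g : β → ℝ | ∀ y, g y ∈ P.I} (entPhi P.Φ q) := by
  refine ⟨fun g hg k hk a b ha hb hab y => P.convex_I (hg y) (hk y) ha hb hab,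
    fun g hg k hk a b ha hb hab => ?_⟩
  have hconv := (P.convexOn_entPhi_line (h := k - g) hq.1 hq.2 hg (by simpa using hk)).2
    (Set.left_mem_Icc.2 zero_le_one) (Set.right_mem_Icc.2 zero_le_one) ha hb hab
  obtain rfl : a = 1 - b := by linarith
  have hpt : ∀ y, g y + b * (k y - g y) = (1 - b) * g y + b * k y := fun y => by ring
  have hmean : ∑ y, q y * g y + b * ∑ y, q y * (k y - g y) =
      ∑ y, q y * ((1 - b) * g y + b * k y) := by
    rw [mul_sum, ← sum_add_distrib]
    exact sum_congr rfl fun y _ => by ring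
  have hone : ∑ y, q y * g y + ∑ y, q y * (k y - g y) = ∑ y, q y * k y := by
    rw [← sum_add_distrib]
    exact sum_congr rfl fun y _ => by ring
  simpa [entPhi, pexp, hpt, hmean, hone] using hconv

/-- Two-variable subadditivity of the Φ-entropy for a product distribution. -/
theorem entPhi_sum_le {α : Type*} [Fintype α] {p : α → ℝ} {q : β → ℝ} (hp : IsPMF p)
    (hq : IsPMF q) {g : α → β → ℝ} (hg : ∀ x y, g x y ∈ P.I) :
    entPhi P.Φ q (fun y => ∑ x, p x * g x y) ≤ ∑ x, p x * entPhi P.Φ q (g x) := by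
  have h := (P.convexOn_entPhi_s3 hq).map_sum_le (t := univ) (w := p) (p := g)
    (fun x _ => hp.1 x) hp.2 (fun x _ => hg x)
  have hfun : ∑ x, p x • g x = fun y => ∑ x, p x * g x y := by
    ext y
    simp
  rwa [hfun] at h

/-- The conditional form of `entPhi_sum_le`, for a joint mass function proportional to the product
of its marginals. -/
theorem sum_sub_sum_condExp_le {α : Type*} [Fintype α] {w : α → β → ℝ} (hw : ∀ x y, 0 ≤ w x y)
    (hprod : ∀ x y, w x y * ∑ x', ∑ y', w x' y' = (∑ y', w x y') * ∑ x', w x' y)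
    {g : α → β → ℝ} (hg : ∀ x y, g x y ∈ P.I) {F : β → ℝ}
    (hF : ∀ y, F y = (∑ x, w x y * g x y) / ∑ x, w x y) :
    ∑ x, ∑ y, w x y * P.Φ (F y) -
        ∑ x, ∑ y, w x y * P.Φ ((∑ x', ∑ y', w x' y' * F y') / ∑ x', ∑ y', w x' y') ≤
      ∑ x, ∑ y, w x y * P.Φ (g x y) -
        ∑ x, ∑ y, w x y * P.Φ ((∑ y', w x y' * g x y') / ∑ y', w x y') := by
  set m := ∑ x, ∑ y, w x y with hm
  have hm0 : 0 ≤ m := sum_nonneg fun x _ => sum_nonneg fun y _ => hw x y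
  rcases hm0.eq_or_lt with hm0 | hmpos
  · have hzero : ∀ x y, w x y = 0 := fun x y =>
      (sum_eq_zero_iff_of_nonneg fun y _ => hw x y).1
        ((sum_eq_zero_iff_of_nonneg fun x _ => sum_nonneg fun y _ => hw x y).1
          hm0.symm x (mem_univ x)) y (mem_univ y)
    simp [hzero]
  set r : α → ℝ := fun x => ∑ y, w x y with hr
  set s : β → ℝ := fun y => ∑ x, w x y with hs
  have hp : IsPMF fun x => r x / m :=
    ⟨fun x => div_nonneg (sum_nonneg fun y _ => hw x y) hm0, by
      rw [← sum_div, div_self hmpos.ne']⟩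
  have hq : IsPMF fun y => s y / m :=
    ⟨fun y => div_nonneg (sum_nonneg fun x _ => hw x y) hm0, by
      rw [← sum_div, hs, sum_comm, div_self hmpos.ne']⟩
  have hwx : ∀ x y, w x y = r x * (s y / m) := fun x y => by
    rw [← mul_div_assoc, eq_div_iff hmpos.ne']
    exact hprod x y
  have hwy : ∀ x y, w x y = s y * (r x / m) := fun x y => by
    rw [hwx]
    ring
  have hG : ∀ x, r x * P.Φ ((∑ y, w x y * g x y) / r x) =
      r x * P.Φ (∑ y, s y / m * g x y) := fun x => by
    rcases eq_or_ne (r x) 0 with h0 | h0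
    · simp [h0]
    · simp_rw [hwx, mul_assoc]
      rw [← mul_sum, mul_div_cancel_left₀ _ h0]
  have hF' : ∀ y, s y ≠ 0 → F y = ∑ x, r x / m * g x y := fun y h0 => by
    rw [hF, show ∑ x, w x y = s y from rfl]
    simp_rw [hwy, mul_assoc]
    rw [← mul_sum, mul_div_cancel_left₀ _ h0]
  have hsF : ∀ φ : ℝ → ℝ, ∑ x, ∑ y, w x y * φ (F y) =
      m * ∑ y, s y / m * φ (∑ x, r x / m * g x y) := fun φ => by
    rw [sum_comm, mul_sum]
    refine sum_congr rfl fun y _ => ?_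
    rw [← sum_mul, ← mul_assoc, mul_div_cancel₀ _ hmpos.ne']
    rcases eq_or_ne (s y) 0 with h0 | h0
    · rw [show ∑ x, w x y = 0 from h0, h0, zero_mul, zero_mul]
    · rw [hF' y h0]
  have hFm : (∑ x, ∑ y, w x y * F y) / m = ∑ y, s y / m * ∑ x, r x / m * g x y := by
    rw [hsF fun t => t, mul_div_cancel_left₀ _ hmpos.ne']
  have hgm : ∑ x, ∑ y, w x y * P.Φ (g x y) =
      m * ∑ x, r x / m * ∑ y, s y / m * P.Φ (g x y) := by
    simp_rw [hwx, mul_assoc, ← mul_sum]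
    rw [mul_sum]
    refine sum_congr rfl fun x _ => ?_
    rw [← mul_assoc, mul_div_cancel₀ _ hmpos.ne']
  have hGm : ∑ x, ∑ y, w x y * P.Φ ((∑ y', w x y' * g x y') / r x) =
      m * ∑ x, r x / m * P.Φ (∑ y, s y / m * g x y) := by
    rw [mul_sum]
    refine sum_congr rfl fun x _ => ?_
    rw [← sum_mul, ← mul_assoc, mul_div_cancel₀ _ hmpos.ne']
    exact hG x
  have hmain := mul_le_mul_of_nonneg_left (P.entPhi_sum_le hp hq hg) hm0
  simp only [entPhi, pexp, mul_sub, sum_sub_distrib] at hmain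
  simp_rw [← sum_mul]
  rw [hsF P.Φ, hFm, hgm]
  simp_rw [sum_mul]
  rw [hGm]
  simpa only [← sum_mul, ← hm] using hmain

end PhiFamily

section Marginals

variable {α γ β : Type*} [Fintype α] [Fintype γ] [Fintype β]

theorem pcexp_fst_mid [DecidableEq α] [DecidableEq γ] (μ f : α × γ × β → ℝ)
    (x : α) (z : γ) (y : β) :
    pcexp μ (fun ω => (ω.1, ω.2.1)) f (x, z, y) =
      (∑ y', μ (x, z, y') * f (x, z, y')) / ∑ y', μ (x, z, y') := by
  simp only [pcexp, Fintype.sum_prod_type, Prod.mk.injEq]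
  congr 1 <;>
  · rw [Fintype.sum_eq_single x fun x' h => by simp [h],
      Fintype.sum_eq_single z fun z' h => by simp [h]]
    simp

theorem pcexp_last_mid [DecidableEq γ] [DecidableEq β] (μ f : α × γ × β → ℝ)
    (x : α) (z : γ) (y : β) :
    pcexp μ (fun ω => (ω.2.2, ω.2.1)) f (x, z, y) =
      (∑ x', μ (x', z, y) * f (x', z, y)) / ∑ x', μ (x', z, y) := by
  simp [pcexp, Fintype.sum_prod_type, ite_and]

theorem pcexp_mid [DecidableEq γ] (μ f : α × γ × β → ℝ) (x : α) (z : γ) (y : β) :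
    pcexp μ (fun ω => ω.2.1) f (x, z, y) =
      (∑ x', ∑ y', μ (x', z, y') * f (x', z, y')) / ∑ x', ∑ y', μ (x', z, y') := by
  simp only [pcexp, Fintype.sum_prod_type]
  congr 1 <;>
  · refine sum_congr rfl fun x' _ => ?_
    rw [Fintype.sum_eq_single z fun z' h => by simp [h]]
    simp

theorem pexp_eq_sum_mid (μ f : α × γ × β → ℝ) :
    pexp μ f = ∑ z, ∑ x, ∑ y, μ (x, z, y) * f (x, z, y) := by
  simp_rw [pexp, Fintype.sum_prod_type]
  exact sum_comm

end Marginals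

/-- for `Φ ∈ 𝓕`, a Markov chain `X → Z → Y` (i.e. `X ⟂ Y | Z`) and any
`I`-valued function `f` of `(X,Z,Y)`, we have `H_Φ(f | X,Z) ≥ H_Φ(E[f | Y,Z] | Z)`.
The sample space is `α × γ × β`, a point `ω = (x, z, y)`. -/
theorem stmt3 (P : PhiFamily)
    {α γ β : Type*} [Fintype α] [Fintype γ] [Fintype β]
    [DecidableEq α] [DecidableEq γ] [DecidableEq β]
    (μ : α × γ × β → ℝ) (hμ : IsPMF μ)
    (hMarkov : ∀ x z y, μ (x, z, y) * (∑ x', ∑ y', μ (x', z, y')) =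
      (∑ y', μ (x, z, y')) * (∑ x', μ (x', z, y)))
    (f : α × γ × β → ℝ) (hf : ∀ ω, f ω ∈ P.I) :
    condEntPhi P.Φ μ f (fun ω => (ω.1, ω.2.1)) ≥
      condEntPhi P.Φ μ (pcexp μ (fun ω => (ω.2.2, ω.2.1)) f) (fun ω => ω.2.1) := by
  simp only [condEntPhi, pexp_eq_sum_mid, pcexp_fst_mid, pcexp_mid, ge_iff_le,
    ← sum_sub_distrib (s := (univ : Finset γ))]
  refine sum_le_sum fun z _ => ?_
  simp only [pcexp_last_mid]
  exact P.sum_sub_sum_condExp_le (w := fun x y => μ (x, z, y)) (g := fun x y => f (x, z, y))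
    (fun x y => hμ.1 _) (fun x y => hMarkov x z y) (fun x y => hf _) fun y => rfl
end

section
/- Every function in 𝓕₁ belongs to 𝓕₂: if Φ is a three-times continuously differentiable convex function on [0,∞) with Φ''' nowhere zero satisfying x + Φ''(x)/Φ'''(x) ≥ y + 3·Φ''(y)/Φ'''(y) for all x,y ≥ 0, then Φ''' ≤ 0 on [0,∞) and, for all x,y ≥ 0 with x ≠ y, (Φ(x) + Φ'(x)(y−x) − Φ(y))·(Φ'(y) − Φ'(x)) + Φ''(x)·(y−x)²·(Φ'(y) − (Φ(x)−Φ(y))/(x−y)) ≥ 0. -/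
/-- Mean value theorem on `[0,∞)`, for endpoints in either order. -/
lemma exists_hasDerivWithinAt_Ici_eq_slope {G G' : ℝ → ℝ}
    (hG : ∀ y ∈ Set.Ici (0:ℝ), HasDerivWithinAt G (G' y) (Set.Ici 0) y)
    {x y : ℝ} (hx : 0 ≤ x) (hy : 0 ≤ y) (hxy : x ≠ y) :
    ∃ c θ : ℝ, 0 ≤ c ∧ 0 < θ ∧ c - x = θ * (y - x) ∧ G y - G x = G' c * (y - x) := by
  have hcont : ContinuousOn G (Set.Ici 0) := fun z hz => (hG z hz).continuousWithinAt
  have hder : ∀ z : ℝ, 0 < z → HasDerivAt G (G' z) z := fun z hz =>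
    (hG z hz.le).hasDerivAt (Ici_mem_nhds hz)
  rcases lt_or_gt_of_ne hxy with h | h
  · obtain ⟨c, hc, hs⟩ := exists_hasDerivAt_eq_slope G G' h
      (hcont.mono fun z hz => hx.trans hz.1) fun z hz => hder z (hx.trans_lt hz.1)
    have h' : 0 < y - x := sub_pos.2 h
    refine ⟨c, (c - x) / (y - x), hx.trans hc.1.le, div_pos (sub_pos.2 hc.1) h', ?_, ?_⟩
    · field_simp
    · rw [hs]; field_simp
  · obtain ⟨c, hc, hs⟩ := exists_hasDerivAt_eq_slope G G' h
      (hcont.mono fun z hz => hy.trans hz.1) fun z hz => hder z (hy.trans_lt hz.1)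
    have h' : 0 < x - y := sub_pos.2 h
    refine ⟨c, (x - c) / (x - y), hy.trans hc.1.le, div_pos (sub_pos.2 hc.2) h', ?_, ?_⟩
    · field_simp; ring
    · rw [hs]; field_simp; ring

/-- A function on `[0,∞)` whose derivative has the sign of `y - x` is minimal at `x`. -/
lemma le_of_hasDerivWithinAt_mul_sub_nonneg {G G' : ℝ → ℝ}
    (hG : ∀ y ∈ Set.Ici (0:ℝ), HasDerivWithinAt G (G' y) (Set.Ici 0) y)
    {x : ℝ} (hx : 0 ≤ x) (hs : ∀ y, 0 ≤ y → 0 ≤ G' y * (y - x)) {y : ℝ} (hy : 0 ≤ y) :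
    G x ≤ G y := by
  rcases eq_or_ne x y with rfl | hxy
  · rfl
  obtain ⟨c, θ, hc, hθ, h1, h2⟩ := exists_hasDerivWithinAt_Ici_eq_slope hG hx hy hxy
  have h3 := hs c hc
  rw [h1, mul_left_comm, ← h2] at h3
  exact sub_nonneg.1 (nonneg_of_mul_nonneg_right h3 hθ)

/-- A function on `[0,∞)` with nonnegative derivative, vanishing at `x`, has the sign of
`y - x`. -/
lemma mul_sub_nonneg_of_hasDerivWithinAt_nonneg {G G' : ℝ → ℝ}
    (hG : ∀ y ∈ Set.Ici (0:ℝ), HasDerivWithinAt G (G' y) (Set.Ici 0) y)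
    {x : ℝ} (hx : 0 ≤ x) (hGx : G x = 0) (hs : ∀ y, 0 ≤ y → 0 ≤ G' y) {y : ℝ} (hy : 0 ≤ y) :
    0 ≤ G y * (y - x) := by
  rcases eq_or_ne x y with rfl | hxy
  · simp
  obtain ⟨c, θ, hc, -, -, h2⟩ := exists_hasDerivWithinAt_Ici_eq_slope hG hx hy hxy
  rw [hGx, sub_zero] at h2
  rw [h2, mul_assoc]
  exact mul_nonneg (hs c hc) (mul_self_nonneg _)

/-- If `(r + a) f''(r)` is nonincreasing, then the function with derivative
`(x + a) f''(x) - (r + a) f''(r)` vanishing at `x` is nonnegative. -/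
lemma nonneg_of_add_mul_nonpos {f f' f'' f''' : ℝ → ℝ}
    (hd1 : ∀ x ∈ Set.Ici (0:ℝ), HasDerivWithinAt f (f' x) (Set.Ici 0) x)
    (hd2 : ∀ x ∈ Set.Ici (0:ℝ), HasDerivWithinAt f' (f'' x) (Set.Ici 0) x)
    (hd3 : ∀ x ∈ Set.Ici (0:ℝ), HasDerivWithinAt f'' (f''' x) (Set.Ici 0) x)
    {a : ℝ} (ha : ∀ r, 0 ≤ r → f'' r + (r + a) * f''' r ≤ 0)
    {x y : ℝ} (hx : 0 ≤ x) (hy : 0 ≤ y) :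
    0 ≤ (x + a) * f'' x * (y - x) - (y + a) * (f' y - f' x) +
      (f y - f x - f' x * (y - x)) := by
  have hG : ∀ r ∈ Set.Ici (0:ℝ), HasDerivWithinAt
      (fun r => (x + a) * f'' x * (r - x) - (r + a) * (f' r - f' x) +
        (f r - f x - f' x * (r - x)))
      ((x + a) * f'' x - (r + a) * f'' r) (Set.Ici 0) r := by
    intro r hr
    have hid := hasDerivWithinAt_id r (Set.Ici (0:ℝ))
    exact (((((hid.sub_const x).const_mul ((x + a) * f'' x))).sub
      ((hid.add_const a).mul ((hd2 r hr).sub_const (f' x)))).add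
      (((hd1 r hr).sub_const (f x)).sub ((hid.sub_const x).const_mul (f' x)))).congr_deriv
        (by simp; ring)
  have hP : ∀ r ∈ Set.Ici (0:ℝ), HasDerivWithinAt
      (fun r => (x + a) * f'' x - (r + a) * f'' r)
      (-(f'' r + (r + a) * f''' r)) (Set.Ici 0) r := by
    intro r hr
    have hid := hasDerivWithinAt_id r (Set.Ici (0:ℝ))
    exact (((hid.add_const a).mul (hd3 r hr)).const_sub ((x + a) * f'' x)).congr_deriv
      (by simp)
  have := le_of_hasDerivWithinAt_mul_sub_nonneg hG hx
    (fun r hr => mul_sub_nonneg_of_hasDerivWithinAt_nonneg hP hx (sub_self _)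
      (fun r hr => neg_nonneg.2 (ha r hr)) hr) hy
  simpa using this

/-- `𝓕₁ ⊆ 𝓕₂`: if `Φ` is a three-times continuously differentiable convex
function on `[0,∞)` (with derivatives `Φ'`, `Φ''`, `Φ'''`) such that `Φ'''` is nowhere zero
and `x + Φ''(x)/Φ'''(x) ≥ y + 3·Φ''(y)/Φ'''(y)` for all `x, y ≥ 0`, then `Φ''' ≤ 0` on
`[0,∞)` and, for all `x, y ≥ 0` with `x ≠ y`,
`(Φ(x) + Φ'(x)(y−x) − Φ(y))·(Φ'(y) − Φ'(x))
  + Φ''(x)·(y−x)²·(Φ'(y) − (Φ(x)−Φ(y))/(x−y)) ≥ 0`. -/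
theorem stmt7 (Φ Φ' Φ'' Φ''' : ℝ → ℝ)
    (hd1 : ∀ x ∈ Set.Ici (0:ℝ), HasDerivWithinAt Φ (Φ' x) (Set.Ici 0) x)
    (hd2 : ∀ x ∈ Set.Ici (0:ℝ), HasDerivWithinAt Φ' (Φ'' x) (Set.Ici 0) x)
    (hd3 : ∀ x ∈ Set.Ici (0:ℝ), HasDerivWithinAt Φ'' (Φ''' x) (Set.Ici 0) x)
    (hcont : ContinuousOn Φ''' (Set.Ici 0))
    (hconv : ConvexOn ℝ (Set.Ici 0) Φ)
    (hne : ∀ x ∈ Set.Ici (0:ℝ), Φ''' x ≠ 0)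
    (hF1 : ∀ x ∈ Set.Ici (0:ℝ), ∀ y ∈ Set.Ici (0:ℝ),
      x + Φ'' x / Φ''' x ≥ y + 3 * (Φ'' y / Φ''' y)) :
    (∀ x ∈ Set.Ici (0:ℝ), Φ''' x ≤ 0) ∧
      ∀ x ∈ Set.Ici (0:ℝ), ∀ y ∈ Set.Ici (0:ℝ), x ≠ y →
        (Φ x + Φ' x * (y - x) - Φ y) * (Φ' y - Φ' x) +
            Φ'' x * (y - x) ^ 2 * (Φ' y - (Φ x - Φ y) / (x - y)) ≥ 0 := by
  have h_nonneg : ∀ x, 0 ≤ x → 0 ≤ Φ'' x := by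
    intro x hx
    have hu := uniqueDiffOn_Ici (0:ℝ)
    have hmono : MonotoneOn Φ' (Set.Ici 0) :=
      (hconv.monotoneOn_derivWithin fun z hz => (hd1 z hz).differentiableWithinAt).congr
        fun z hz => (hd1 z hz).derivWithin (hu z hz)
    rw [← (hd2 x hx).derivWithin (hu x hx)]
    exact hmono.derivWithin_nonneg
  have h_neg : ∀ x, 0 ≤ x → Φ''' x < 0 := by
    intro p hp
    by_contra! hpos
    have hpos : 0 < Φ''' p := lt_of_le_of_ne hpos (hne p hp).symm
    obtain ⟨q, hq, hq0⟩ : ∃ q, 0 ≤ q ∧ Φ''' q ≤ 0 := by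
      by_contra! hall
      have hnn : ∀ z, 0 ≤ z → 0 ≤ Φ'' z / Φ''' z := fun z hz =>
        div_nonneg (h_nonneg z hz) (hall z hz).le
      have hq : 0 ≤ p + Φ'' p / Φ''' p + 1 := by linarith [hnn p hp]
      linarith [hF1 p hp _ hq, hnn _ hq]
    obtain ⟨z, hz, hz0⟩ := isPreconnected_Ici.intermediate_value (Set.mem_Ici.2 hq)
      (Set.mem_Ici.2 hp) hcont ⟨hq0, hpos.le⟩
    exact hne z hz hz0
  refine ⟨fun x hx => (h_neg x hx).le, fun x hx y hy hxy => ?_⟩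
  have hF : ∀ r ∈ Set.Ici (0:ℝ), HasDerivWithinAt
      (fun r => Φ'' x * (r - x) * (Φ x - Φ r + Φ' r * (r - x)) -
        (Φ r - Φ x - Φ' x * (r - x)) * (Φ' r - Φ' x))
      (Φ'' x * (Φ x - Φ r + Φ' r * (r - x)) + Φ'' x * ((r - x) * (r - x)) * Φ'' r -
        (Φ' r - Φ' x) * (Φ' r - Φ' x) - (Φ r - Φ x - Φ' x * (r - x)) * Φ'' r)
      (Set.Ici 0) r := by
    intro r hr
    have hid := (hasDerivWithinAt_id r (Set.Ici (0:ℝ))).sub_const x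
    exact (((hid.const_mul (Φ'' x)).mul
      (((hd1 r hr).const_sub (Φ x)).add ((hd2 r hr).mul hid))).sub
      ((((hd1 r hr).sub_const (Φ x)).sub (hid.const_mul (Φ' x))).mul
        ((hd2 r hr).sub_const (Φ' x)))).congr_deriv (by simp; ring)
  have hF' : ∀ r ∈ Set.Ici (0:ℝ), HasDerivWithinAt
      (fun r => Φ'' x * (Φ x - Φ r + Φ' r * (r - x)) + Φ'' x * ((r - x) * (r - x)) * Φ'' r -
        (Φ' r - Φ' x) * (Φ' r - Φ' x) - (Φ r - Φ x - Φ' x * (r - x)) * Φ'' r)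
      (3 * Φ'' r * (Φ'' x * (r - x) - (Φ' r - Φ' x)) +
        Φ''' r * (Φ'' x * (r - x) ^ 2 - (Φ r - Φ x - Φ' x * (r - x))))
      (Set.Ici 0) r := by
    intro r hr
    have hid := (hasDerivWithinAt_id r (Set.Ici (0:ℝ))).sub_const x
    have hE := (hd2 r hr).sub_const (Φ' x)
    exact (((((((hd1 r hr).const_sub (Φ x)).add ((hd2 r hr).mul hid)).const_mul (Φ'' x)).add
      (((hid.mul hid).const_mul (Φ'' x)).mul (hd3 r hr))).sub (hE.mul hE)).sub
      ((((hd1 r hr).sub_const (Φ x)).sub (hid.const_mul (Φ' x))).mul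
        (hd3 r hr))).congr_deriv (by simp; ring)
  have hF'' : ∀ r, 0 ≤ r → 0 ≤ 3 * Φ'' r * (Φ'' x * (r - x) - (Φ' r - Φ' x)) +
        Φ''' r * (Φ'' x * (r - x) ^ 2 - (Φ r - Φ x - Φ' x * (r - x))) := by
    intro r hr
    have hk := h_neg r hr
    have hk0 : Φ''' r ≠ 0 := hk.ne
    obtain ⟨a, ha⟩ : ∃ a, r + a = -(3 * (Φ'' r / Φ''' r)) :=
      ⟨-(3 * (Φ'' r / Φ''' r)) - r, by ring⟩
    have hk3 : 3 * Φ'' r = -(Φ''' r * (r + a)) := by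
      rw [ha]
      field_simp
    have hG := nonneg_of_add_mul_nonpos hd1 hd2 hd3 (a := a) (x := x) (y := r) (fun z hz => by
      have h1 : 0 ≤ Φ'' z / Φ''' z + (z + a) := by linarith [hF1 z hz r hr]
      have h2 := mul_nonpos_of_nonpos_of_nonneg (h_neg z hz).le h1
      rw [mul_add, mul_div_cancel₀ _ (hne z hz)] at h2
      linarith) hx hr
    rw [hk3]
    linear_combination mul_nonneg (neg_nonneg.2 hk.le) hG
  have key := le_of_hasDerivWithinAt_mul_sub_nonneg hF hx
    (fun r hr => mul_sub_nonneg_of_hasDerivWithinAt_nonneg hF' hx (by simp) hF'' hr) hy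
  have hxy' : x - y ≠ 0 := sub_ne_zero.2 hxy
  have hslope : (y - x) ^ 2 * (Φ' y - (Φ x - Φ y) / (x - y)) =
      (y - x) * (Φ x - Φ y + Φ' y * (y - x)) := by
    field_simp
    ring
  rw [mul_assoc (Φ'' x), hslope]
  simp only [sub_self, mul_zero, zero_mul] at key
  linear_combination key
end

section
/- Let Φ ∈ 𝓕₂ with Φ'' > 0 on [0,∞), let s,d ∈ (0,1), and let m > 0. For v ∈ [0, m/s] with v ≠ m define g(v) = [ (1−s(1−d))·Φ((m − s(1−d)v)/(1 − s(1−d))) + s(1−d)·Φ(v) − Φ(m) ] / [ (1−s)·Φ((m − s v)/(1−s)) + s·Φ(v) − Φ(m) ] (the denominator is strictly positive since Φ is strictly convex and v ≠ m). Then g is nonincreasing: for all 0 ≤ v < v' ≤ m/s with v ≠ m and v' ≠ m, g(v') ≤ g(v). -/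
open Set Filter Topology

theorem monotoneOn_of_hasDerivWithinAt_Ici_nonneg {f f' : ℝ → ℝ} {D : Set ℝ} (hD : Convex ℝ D)
    (hD0 : D ⊆ Ici 0) (hf : ∀ x ∈ Ici (0 : ℝ), HasDerivWithinAt f (f' x) (Ici 0) x)
    (hf' : ∀ x ∈ D, 0 ≤ f' x) : MonotoneOn f D :=
  monotoneOn_of_hasDerivWithinAt_nonneg hD
    (fun x hx => (hf x (hD0 hx)).continuousWithinAt.mono hD0)
    (fun x hx => (hf x (hD0 (interior_subset hx))).mono (interior_subset.trans hD0))
    (fun x hx => hf' x (interior_subset hx))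

theorem hasDerivAt_of_hasDerivWithinAt_Ici {f : ℝ → ℝ} {f' x : ℝ} (hx : 0 < x)
    (hf : HasDerivWithinAt f f' (Ici 0) x) : HasDerivAt f f' x :=
  hf.hasDerivAt (Ici_mem_nhds hx)

/-- The tangent-line inequality for a function with nonincreasing derivative. -/
theorem mul_sub_le_of_antitoneOn_deriv {f f' : ℝ → ℝ}
    (hf : ∀ x ∈ Ici (0 : ℝ), HasDerivWithinAt f (f' x) (Ici 0) x)
    (hf' : AntitoneOn f' (Ici 0)) {x y : ℝ} (hx : 0 ≤ x) (hy : 0 ≤ y) :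
    (x - y) * f' x ≤ f x - f y := by
  have hslope : ∀ a b : ℝ, 0 ≤ a → a < b → ∃ c ∈ Ioo a b, f' c = (f b - f a) / (b - a) :=
    fun a b ha hab => exists_hasDerivAt_eq_slope f f' hab
      (fun t ht => ((hf t (ha.trans ht.1)).continuousWithinAt).mono
        (fun r hr => ha.trans hr.1))
      (fun t ht => hasDerivAt_of_hasDerivWithinAt_Ici (ha.trans_lt ht.1)
        (hf t (ha.trans ht.1.le)))
  rcases lt_trichotomy x y with h | rfl | h
  · obtain ⟨c, hc, hc'⟩ := hslope x y hx h
    rw [eq_div_iff (by linarith)] at hc'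
    have := hf' (mem_Ici.2 hx) (mem_Ici.2 (hx.trans hc.1.le)) hc.1.le
    nlinarith
  · simp
  · obtain ⟨c, hc, hc'⟩ := hslope y x hy h
    rw [eq_div_iff (by linarith)] at hc'
    have := hf' (mem_Ici.2 (hy.trans hc.1.le)) (mem_Ici.2 hx) hc.2.le
    nlinarith

/-- Comparison of the Bregman remainder with its quadratic approximation. -/
theorem bregman_quadratic_comparison {Φ Φ' Φ'' : ℝ → ℝ}
    (hd1 : ∀ x ∈ Ici (0 : ℝ), HasDerivWithinAt Φ (Φ' x) (Ici 0) x)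
    (hd2 : ∀ x ∈ Ici (0 : ℝ), HasDerivWithinAt Φ' (Φ'' x) (Ici 0) x)
    (hanti : AntitoneOn Φ'' (Ici 0)) {w : ℝ} (hw : 0 ≤ w) :
    MonotoneOn (fun t => Φ'' w * (t - w) ^ 2 - 2 * (Φ t - Φ w - Φ' w * (t - w))) (Ici 0) := by
  refine monotoneOn_of_hasDerivWithinAt_Ici_nonneg (convex_Ici 0) subset_rfl
    (f' := fun t => Φ'' w * (2 * (t - w)) - 2 * (Φ' t - Φ' w)) (fun t ht => ?_) (fun t ht => ?_)
  · have hid : HasDerivWithinAt (fun t : ℝ => t - w) 1 (Ici 0) t :=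
      (hasDerivWithinAt_id t _).sub_const w
    refine ((hid.pow 2).const_mul (Φ'' w)).sub
      ((((hd1 t ht).sub_const (Φ w)).sub (hid.const_mul (Φ' w))).const_mul 2) |>.congr_deriv ?_
    simp
  · have := mul_sub_le_of_antitoneOn_deriv hd2 hanti hw ht
    nlinarith


/-- The three-point inequality obtained from the two-point condition at `(w, m)`. -/
theorem three_point_inequality {Φ Φ' Φ'' : ℝ → ℝ}
    (hd1 : ∀ x ∈ Ici (0 : ℝ), HasDerivWithinAt Φ (Φ' x) (Ici 0) x)
    (hd2 : ∀ x ∈ Ici (0 : ℝ), HasDerivWithinAt Φ' (Φ'' x) (Ici 0) x)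
    (hanti : AntitoneOn Φ'' (Ici 0)) (hnonneg : ∀ x ∈ Ici (0 : ℝ), 0 ≤ Φ'' x)
    {w m v : ℝ} (hw : 0 ≤ w) (hm : 0 ≤ m) (hv : 0 ≤ v) (hwm : w ≠ m)
    (hF : (Φ w + Φ' w * (m - w) - Φ m) * (Φ' m - Φ' w) +
      Φ'' w * (m - w) ^ 2 * (Φ' m - (Φ w - Φ m) / (w - m)) ≥ 0)
    (hmid : 0 ≤ (m - w) * (v - m)) :
    0 ≤ (v - w) * (Φ'' w * (m - w) ^ 2 * (Φ v - Φ w - Φ' w * (v - w)) -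
      (Φ m - Φ w - Φ' w * (m - w)) *
        ((v - m) * (Φ' v - Φ' w) + Φ'' w * (m - w) * (v - w))) := by
  have hmono : MonotoneOn Φ' (Ici 0) :=
    monotoneOn_of_hasDerivWithinAt_Ici_nonneg (convex_Ici 0) subset_rfl hd2 hnonneg
  have hC : 0 ≤ Φ m - Φ w - Φ' w * (m - w) := by
    have := mul_sub_le_of_antitoneOn_deriv (f := fun x => -Φ x) (f' := fun x => -Φ' x)
      (fun x hx => (hd1 x hx).neg) hmono.neg hw hm
    linarith
  have hquad := bregman_quadratic_comparison hd1 hd2 hanti hw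
  set C := Φ m - Φ w - Φ' w * (m - w) with hCdef
  have hF' : 0 ≤ Φ'' w * (m - w) ^ 2 * (Φ' m - Φ' w) - C * (Φ' m - Φ' w) -
      C * (Φ'' w * (m - w)) := by
    have hne : w - m ≠ 0 := sub_ne_zero.2 hwm
    have : Φ'' w * (m - w) ^ 2 * (Φ' m - (Φ w - Φ m) / (w - m)) =
        Φ'' w * (m - w) ^ 2 * Φ' m - Φ'' w * (m - w) * (Φ m - Φ w) := by
      field_simp
      ring
    rw [this] at hF
    rw [hCdef]
    linarith
  set Z : ℝ → ℝ := fun t => Φ'' w * (m - w) ^ 2 * (Φ t - Φ w - Φ' w * (t - w)) -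
      C * ((t - m) * (Φ' t - Φ' w) + Φ'' w * (m - w) * (t - w)) with hZ
  have hZm : Z m = 0 := by
    simp only [hZ, hCdef]
    ring
  have hderiv : ∀ t ∈ Ici (0 : ℝ), HasDerivWithinAt Z
      (Φ'' w * (m - w) ^ 2 * (Φ' t - Φ' w) -
        C * (Φ' t - Φ' w + (t - m) * Φ'' t + Φ'' w * (m - w))) (Ici 0) t := by
    intro t ht
    have hid : ∀ a : ℝ, HasDerivWithinAt (fun t : ℝ => t - a) 1 (Ici 0) t :=
      fun a => (hasDerivWithinAt_id t _).sub_const a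
    refine ((((hd1 t ht).sub_const (Φ w)).sub ((hid w).const_mul (Φ' w))).const_mul
      (Φ'' w * (m - w) ^ 2)).sub ((((hid m).mul ((hd2 t ht).sub_const (Φ' w))).add
      ((hid w).const_mul (Φ'' w * (m - w)))).const_mul C) |>.congr_deriv ?_
    simp
  have hpos : ∀ t ∈ Ici (0 : ℝ),
      0 ≤ (Φ'' w * (m - w) ^ 2 - 2 * C) * (Φ' t - Φ' m) →
      0 ≤ Φ'' w * (m - w) ^ 2 * (Φ' t - Φ' w) -
        C * (Φ' t - Φ' w + (t - m) * Φ'' t + Φ'' w * (m - w)) := by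
    intro t ht h
    have := mul_nonneg hC (sub_nonneg.2 (mul_sub_le_of_antitoneOn_deriv hd2 hanti ht hm))
    linarith
  rcases lt_or_gt_of_ne hwm with h | h
  · have hmv : m ≤ v := by nlinarith
    refine mul_nonneg (by linarith) ?_
    rw [← hZm]
    refine monotoneOn_of_hasDerivWithinAt_Ici_nonneg (convex_Ici m) (Ici_subset_Ici.2 hm) hderiv
      (fun t ht => hpos t (hm.trans ht) (mul_nonneg ?_ ?_)) self_mem_Ici hmv hmv
    · have := hquad (mem_Ici.2 hw) (mem_Ici.2 hm) h.le
      simp at this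
      linarith
    · exact sub_nonneg.2 (hmono hm (hm.trans ht) ht)
  · have hmv : v ≤ m := by nlinarith
    refine mul_nonneg_of_nonpos_of_nonpos (by linarith) ?_
    rw [← hZm]
    refine monotoneOn_of_hasDerivWithinAt_Ici_nonneg (convex_Icc 0 m) Icc_subset_Ici_self hderiv
      (fun t ht => hpos t ht.1 (mul_nonneg_of_nonpos_of_nonpos ?_ ?_)) ⟨hv, hmv⟩ ⟨hm, le_rfl⟩ hmv
    · have := hquad (mem_Ici.2 hm) (mem_Ici.2 hw) h.le
      simp at this
      linarith
    · exact sub_nonpos.2 (hmono ht.1 hm ht.2)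

/-- The `Φ`-entropy of a two-valued function with mean `m` taking the value `v` with
probability `p`. -/
noncomputable def twoPointEntropy (Φ : ℝ → ℝ) (m p v : ℝ) : ℝ :=
  (1 - p) * Φ ((m - p * v) / (1 - p)) + p * Φ v - Φ m

/-- The derivative of `twoPointEntropy` in `v`, where `Φ'` is the derivative of `Φ`. -/
noncomputable def twoPointEntropyDeriv (Φ' : ℝ → ℝ) (m p v : ℝ) : ℝ :=
  p * (Φ' v - Φ' ((m - p * v) / (1 - p)))

theorem twoPointEntropy_pos {Φ : ℝ → ℝ} (hΦ : StrictConvexOn ℝ (Ici 0) Φ) {m p v : ℝ}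
    (hp0 : 0 < p) (hp1 : p < 1) (hv : 0 ≤ v) (hpv : p * v ≤ m) (hvm : v ≠ m) :
    0 < twoPointEntropy Φ m p v := by
  have h1 : 0 < 1 - p := by linarith
  have hw : 0 ≤ (m - p * v) / (1 - p) := div_nonneg (by linarith) h1.le
  have hne : (m - p * v) / (1 - p) ≠ v := by
    intro h
    rw [div_eq_iff h1.ne'] at h
    apply hvm
    linarith
  have := hΦ.2 (mem_Ici.2 hw) (mem_Ici.2 hv) hne h1 hp0 (by ring)
  simp only [smul_eq_mul] at this
  rw [mul_div_cancel₀ _ h1.ne', sub_add_cancel] at this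
  rw [twoPointEntropy]
  linarith

theorem hasDerivAt_twoPointEntropy {Φ Φ' : ℝ → ℝ}
    (hd1 : ∀ x ∈ Ici (0 : ℝ), HasDerivWithinAt Φ (Φ' x) (Ici 0) x) {m p v : ℝ}
    (hp1 : p < 1) (hv : 0 < v) (hpv : p * v < m) :
    HasDerivAt (twoPointEntropy Φ m p) (twoPointEntropyDeriv Φ' m p v) v := by
  have h1 : 0 < 1 - p := by linarith
  have hw : 0 < (m - p * v) / (1 - p) := div_pos (by linarith) h1
  have hwd : HasDerivAt (fun v => (m - p * v) / (1 - p)) (-p / (1 - p)) v := by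
    refine ((((hasDerivAt_id v).const_mul p).const_sub m).div_const (1 - p)).congr_deriv ?_
    simp
  have hΦw := (hasDerivAt_of_hasDerivWithinAt_Ici hw (hd1 _ hw.le)).comp v hwd
  have hΦv := hasDerivAt_of_hasDerivWithinAt_Ici hv (hd1 _ hv.le)
  refine (((hΦw.const_mul (1 - p)).add (hΦv.const_mul p)).sub_const (Φ m)).congr_deriv ?_
  rw [twoPointEntropyDeriv]
  field_simp
  ring

theorem hasDerivAt_twoPointEntropyDeriv {Φ' Φ'' : ℝ → ℝ}
    (hd2 : ∀ x ∈ Ici (0 : ℝ), HasDerivWithinAt Φ' (Φ'' x) (Ici 0) x) {m p : ℝ}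
    (hm : 0 < m) (hp1 : p < 1) :
    HasDerivAt (twoPointEntropyDeriv Φ' m p) (p / (1 - p) * Φ'' m) m := by
  have h1 : 0 < 1 - p := by linarith
  have hw : (m - p * m) / (1 - p) = m := by
    field_simp
  have hwd : HasDerivAt (fun v => (m - p * v) / (1 - p)) (-p / (1 - p)) m := by
    refine ((((hasDerivAt_id m).const_mul p).const_sub m).div_const (1 - p)).congr_deriv ?_
    simp
  have hΦm := hasDerivAt_of_hasDerivWithinAt_Ici hm (hd2 _ hm.le)
  have hΦw := HasDerivAt.comp m (by simpa only [hw] using hΦm) hwd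
  refine ((hΦm.sub hΦw).const_mul p).congr_deriv ?_
  field_simp
  ring

theorem twoPointEntropyDeriv_div_monotone {Φ Φ' Φ'' : ℝ → ℝ}
    (hd1 : ∀ x ∈ Ici (0 : ℝ), HasDerivWithinAt Φ (Φ' x) (Ici 0) x)
    (hd2 : ∀ x ∈ Ici (0 : ℝ), HasDerivWithinAt Φ' (Φ'' x) (Ici 0) x)
    (hΦ : StrictConvexOn ℝ (Ici 0) Φ)
    (hanti : AntitoneOn Φ'' (Ici 0)) (hnonneg : ∀ x ∈ Ici (0 : ℝ), 0 ≤ Φ'' x)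
    (hF2 : ∀ x ∈ Ici (0 : ℝ), ∀ y ∈ Ici (0 : ℝ), x ≠ y →
      (Φ x + Φ' x * (y - x) - Φ y) * (Φ' y - Φ' x) +
          Φ'' x * (y - x) ^ 2 * (Φ' y - (Φ x - Φ y) / (x - y)) ≥ 0)
    {m p q v : ℝ} (hq : 0 < q) (hqp : q ≤ p) (hp1 : p < 1) (hv : 0 < v) (hpv : p * v < m)
    (hvm : v ≠ m) :
    twoPointEntropyDeriv Φ' m q v / twoPointEntropy Φ m q v ≤
      twoPointEntropyDeriv Φ' m p v / twoPointEntropy Φ m p v := by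
  set w : ℝ → ℝ := fun x => (m - x * v) / (1 - x) with hwdef
  have hxv : ∀ x ∈ Icc q p, x * v < m := fun x hx =>
    (mul_le_mul_of_nonneg_right hx.2 hv.le).trans_lt hpv
  have hw : ∀ x ∈ Icc q p, 0 < w x := fun x hx =>
    div_pos (by linarith [hxv x hx]) (by linarith [hx.2])
  have hF : ∀ x ∈ Icc q p, 0 < twoPointEntropy Φ m x v := fun x hx =>
    twoPointEntropy_pos hΦ (hq.trans_le hx.1) (hx.2.trans_lt hp1) hv.le (hxv x hx).le hvm
  have hwd : ∀ x ∈ Icc q p, HasDerivAt w ((w x - v) / (1 - x)) x := by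
    intro x hx
    have h1 : 1 - x ≠ 0 := by linarith [hx.2]
    refine ((((hasDerivAt_id x).mul_const v).const_sub m).div
      ((hasDerivAt_id x).const_sub 1) h1).congr_deriv ?_
    simp only [hwdef, id]
    field_simp
    ring
  have hFd : ∀ x ∈ Icc q p, HasDerivAt (fun x => twoPointEntropy Φ m x v)
      (Φ v - Φ (w x) - Φ' (w x) * (v - w x)) x := by
    intro x hx
    have h1 : 1 - x ≠ 0 := by linarith [hx.2]
    have hΦw := (hasDerivAt_of_hasDerivWithinAt_Ici (hw x hx) (hd1 _ (hw x hx).le)).comp x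
      (hwd x hx)
    refine (((((hasDerivAt_id x).const_sub 1).mul hΦw).add
      ((hasDerivAt_id x).mul_const (Φ v))).sub_const (Φ m)).congr_deriv ?_
    simp only [id, Function.comp]
    field_simp
    ring
  have hNd : ∀ x ∈ Icc q p, HasDerivAt (fun x => twoPointEntropyDeriv Φ' m x v)
      (Φ' v - Φ' (w x) + x * (Φ'' (w x) * (v - w x)) / (1 - x)) x := by
    intro x hx
    have h1 : 1 - x ≠ 0 := by linarith [hx.2]
    have hΦw := (hasDerivAt_of_hasDerivWithinAt_Ici (hw x hx) (hd2 _ (hw x hx).le)).comp x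
      (hwd x hx)
    refine ((hasDerivAt_id x).mul (hΦw.const_sub (Φ' v))).congr_deriv ?_
    simp only [id, Function.comp]
    field_simp
    ring
  have hRd := fun x hx => (hNd x hx).div (hFd x hx) (hF x hx).ne'
  refine monotoneOn_of_hasDerivWithinAt_nonneg (convex_Icc q p)
    (fun x hx => (hRd x hx).continuousAt.continuousWithinAt)
    (fun x hx => (hRd x (interior_subset hx)).hasDerivWithinAt) (fun x hx => ?_)
    (left_mem_Icc.2 hqp) (right_mem_Icc.2 hqp) hqp
  replace hx := interior_subset hx
  refine div_nonneg ?_ (sq_nonneg _)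
  have hx0 : 0 < x := hq.trans_le hx.1
  have h1 : 0 < 1 - x := by linarith [hx.2]
  have hwx : w x * (1 - x) = m - x * v := div_mul_cancel₀ _ h1.ne'
  have hvw : v - w x ≠ 0 := by
    intro h
    apply hvm
    have : w x = v := by linarith
    rw [this] at hwx
    linarith
  have hmw : m - w x = x * (v - w x) := by linarith
  have hvm' : v - m = (1 - x) * (v - w x) := by linarith
  have hmem : 0 ≤ m := (mul_pos hx0 hv).le.trans (hxv x hx).le
  have hwm : w x ≠ m := by
    intro h
    rw [h, sub_self] at hmw
    rw [h] at hvw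
    exact (mul_ne_zero hx0.ne' hvw) hmw.symm
  have key := three_point_inequality hd1 hd2 hanti hnonneg (hw x hx).le hmem hv.le hwm
    (hF2 _ (hw x hx).le _ hmem hwm)
    (by rw [hmw, hvm']; nlinarith [mul_nonneg (mul_pos hx0 h1).le (sq_nonneg (v - w x))])
  rw [hvm', hmw] at key
  have hE : twoPointEntropy Φ m x v = (1 - x) * Φ (w x) + x * Φ v - Φ m := rfl
  have hE' : twoPointEntropyDeriv Φ' m x v = x * (Φ' v - Φ' (w x)) := rfl
  rw [hE, hE']
  refine nonneg_of_mul_nonneg_right (a := (1 - x) * (v - w x) ^ 2) ?_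
    (mul_pos h1 (by positivity))
  have hcancel : x * (Φ'' (w x) * (v - w x)) / (1 - x) * (1 - x) = x * (Φ'' (w x) * (v - w x)) :=
    div_mul_cancel₀ _ h1.ne'
  refine key.trans_eq ?_
  linear_combination -(v - w x) ^ 2 * ((1 - x) * Φ (w x) + x * Φ v - Φ m) * hcancel

theorem twoPointEntropyDeriv_ne_zero {Φ' : ℝ → ℝ} (hmono : StrictMonoOn Φ' (Ici 0)) {m p v : ℝ}
    (hp0 : 0 < p) (hp1 : p < 1) (hv : 0 ≤ v) (hpv : p * v ≤ m) (hvm : v ≠ m) :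
    twoPointEntropyDeriv Φ' m p v ≠ 0 := by
  have h1 : 0 < 1 - p := by linarith
  have hw : 0 ≤ (m - p * v) / (1 - p) := div_nonneg (by linarith) h1.le
  refine mul_ne_zero hp0.ne' (sub_ne_zero.2 fun h => ?_)
  have := hmono.injOn (mem_Ici.2 hv) (mem_Ici.2 hw) h
  rw [eq_div_iff h1.ne'] at this
  apply hvm
  linarith

theorem twoPointEntropy_self (Φ : ℝ → ℝ) {m p : ℝ} (hp1 : p < 1) :
    twoPointEntropy Φ m p m = 0 := by
  have h1 : 1 - p ≠ 0 := by linarith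
  have hw : (m - p * m) / (1 - p) = m := by
    field_simp
  rw [twoPointEntropy, hw]
  ring

theorem twoPointEntropyDeriv_self (Φ' : ℝ → ℝ) {m p : ℝ} (hp1 : p < 1) :
    twoPointEntropyDeriv Φ' m p m = 0 := by
  have h1 : 1 - p ≠ 0 := by linarith
  have hw : (m - p * m) / (1 - p) = m := by
    field_simp
  rw [twoPointEntropyDeriv, hw]
  ring

theorem continuousOn_twoPointEntropy {Φ : ℝ → ℝ} (hΦ : ContinuousOn Φ (Ici 0))
    {m p : ℝ} {D : Set ℝ} (hp1 : p < 1) (hD : ∀ v ∈ D, 0 ≤ v ∧ p * v ≤ m) :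
    ContinuousOn (twoPointEntropy Φ m p) D := by
  have hw : ContinuousOn (fun v => (m - p * v) / (1 - p)) D := by fun_prop
  refine ((continuousOn_const.mul (hΦ.comp hw fun v hv => ?_)).add
    (continuousOn_const.mul (hΦ.mono fun v hv => (hD v hv).1))).sub continuousOn_const
  have hpv := (hD v hv).2
  have h1 : 0 < 1 - p := by linarith
  exact mem_Ici.2 (div_nonneg (by linarith) h1.le)

/-- The limit at the mean of the ratio of two entropies. -/
theorem tendsto_twoPointEntropy_div {Φ Φ' Φ'' : ℝ → ℝ}
    (hd1 : ∀ x ∈ Ici (0 : ℝ), HasDerivWithinAt Φ (Φ' x) (Ici 0) x)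
    (hd2 : ∀ x ∈ Ici (0 : ℝ), HasDerivWithinAt Φ' (Φ'' x) (Ici 0) x)
    (hmono : StrictMonoOn Φ' (Ici 0)) {m p q : ℝ} (hm : 0 < m) (hpos : Φ'' m ≠ 0)
    (hp0 : 0 < p) (hp1 : p < 1) (hq1 : q < 1) :
    Tendsto (fun v => twoPointEntropy Φ m q v / twoPointEntropy Φ m p v) (𝓝[≠] m)
      (𝓝 (q / (1 - q) * Φ'' m / (p / (1 - p) * Φ'' m))) := by
  have hnear : ∀ r < 1, ∀ᶠ v in 𝓝[≠] m, 0 < v ∧ r * v < m ∧ v ≠ m := by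
    intro r hr
    have h1 : ∀ᶠ v in 𝓝 m, 0 < v := eventually_gt_nhds hm
    have h2 : ∀ᶠ v in 𝓝 m, r * v < m :=
      (continuous_const.mul continuous_id).continuousAt.eventually_lt continuousAt_const
        (by simpa using mul_lt_of_lt_one_left hm hr)
    filter_upwards [nhdsWithin_le_nhds h1, nhdsWithin_le_nhds h2, self_mem_nhdsWithin]
      with v hv1 hv2 hv3 using ⟨hv1, hv2, hv3⟩
  have hzero : ∀ r < 1, Tendsto (twoPointEntropy Φ m r) (𝓝[≠] m) (𝓝 0) := by
    intro r hr
    have := (hasDerivAt_twoPointEntropy hd1 hr hm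
      (mul_lt_of_lt_one_left hm hr)).continuousAt.tendsto
    rw [twoPointEntropy_self Φ hr] at this
    exact this.mono_left nhdsWithin_le_nhds
  refine HasDerivAt.lhopital_zero_nhdsNE (f' := twoPointEntropyDeriv Φ' m q)
    (g' := twoPointEntropyDeriv Φ' m p) ?_ ?_ ?_ (hzero q hq1) (hzero p hp1) ?_
  · filter_upwards [hnear q hq1] with v hv using hasDerivAt_twoPointEntropy hd1 hq1 hv.1 hv.2.1
  · filter_upwards [hnear p hp1] with v hv using hasDerivAt_twoPointEntropy hd1 hp1 hv.1 hv.2.1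
  · filter_upwards [hnear p hp1] with v hv using
      twoPointEntropyDeriv_ne_zero hmono hp0 hp1 hv.1.le hv.2.1.le hv.2.2
  · have hslope := fun r hr => hasDerivAt_iff_tendsto_slope.1
      (hasDerivAt_twoPointEntropyDeriv (p := r) hd2 hm hr)
    have h1p : 1 - p ≠ 0 := by linarith
    refine ((hslope q hq1).div (hslope p hp1) (by positivity)).congr' ?_
    filter_upwards [self_mem_nhdsWithin] with v hv
    simp only [Pi.div_apply, slope_def_field, twoPointEntropyDeriv_self Φ' hq1,
      twoPointEntropyDeriv_self Φ' hp1, sub_zero]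
    exact div_div_div_cancel_right₀ (sub_ne_zero.2 hv) _ _


/-- The ratio `g(v) = H_Φ(E[f|Y])/H_Φ(f)` for a Z-channel source with parameters `s, d`
and `f : {0,1} → [0,∞)` with `f(1) = v` and mean `E[f] = m`. -/
noncomputable def gfun (Φ : ℝ → ℝ) (s d m v : ℝ) : ℝ :=
  ((1 - s * (1 - d)) * Φ ((m - s * (1 - d) * v) / (1 - s * (1 - d))) +
      s * (1 - d) * Φ v - Φ m) /
    ((1 - s) * Φ ((m - s * v) / (1 - s)) + s * Φ v - Φ m)

/-- for `Φ ∈ 𝓕₂` with `Φ'' > 0` on `[0,∞)`, `s, d ∈ (0,1)` and `m > 0`,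
the function `g` is nonincreasing on `[0, m/s] \ {m}`: if `0 ≤ v < v' ≤ m/s` with
`v ≠ m` and `v' ≠ m`, then `g(v') ≤ g(v)`. -/
theorem stmt9 (Φ Φ' Φ'' Φ''' : ℝ → ℝ)
    (hd1 : ∀ x ∈ Set.Ici (0:ℝ), HasDerivWithinAt Φ (Φ' x) (Set.Ici 0) x)
    (hd2 : ∀ x ∈ Set.Ici (0:ℝ), HasDerivWithinAt Φ' (Φ'' x) (Set.Ici 0) x)
    (hd3 : ∀ x ∈ Set.Ici (0:ℝ), HasDerivWithinAt Φ'' (Φ''' x) (Set.Ici 0) x)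
    (hconv : ConvexOn ℝ (Set.Ici 0) Φ)
    (h3 : ∀ x ∈ Set.Ici (0:ℝ), Φ''' x ≤ 0)
    (h2pos : ∀ x ∈ Set.Ici (0:ℝ), 0 < Φ'' x)
    (hF2 : ∀ x ∈ Set.Ici (0:ℝ), ∀ y ∈ Set.Ici (0:ℝ), x ≠ y →
      (Φ x + Φ' x * (y - x) - Φ y) * (Φ' y - Φ' x) +
          Φ'' x * (y - x) ^ 2 * (Φ' y - (Φ x - Φ y) / (x - y)) ≥ 0)
    (s d m : ℝ) (hs : s ∈ Set.Ioo (0:ℝ) 1) (hd : d ∈ Set.Ioo (0:ℝ) 1) (hm : 0 < m)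
    (v v' : ℝ) (hv0 : 0 ≤ v) (hvv' : v < v') (hv'le : v' ≤ m / s)
    (hvm : v ≠ m) (hv'm : v' ≠ m) :
    gfun Φ s d m v' ≤ gfun Φ s d m v := by
  have hs0 := hs.1
  have hs1 := hs.2
  have hq0 : 0 < s * (1 - d) := mul_pos hs0 (by linarith [hd.2])
  have hqs : s * (1 - d) ≤ s := by nlinarith [mul_pos hs0 hd.1]
  set q := s * (1 - d) with hq
  have hq1 : q < 1 := hqs.trans_lt hs1
  have hΦc : ContinuousOn Φ (Ici 0) := fun x hx => (hd1 x hx).continuousWithinAt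
  have hmono : StrictMonoOn Φ' (Ici 0) :=
    strictMonoOn_of_hasDerivWithinAt_pos (convex_Ici 0)
      (fun x hx => (hd2 x hx).continuousWithinAt)
      (fun x hx => (hd2 x (interior_subset hx)).mono interior_subset)
      (fun x hx => h2pos x (interior_subset hx))
  have hanti : AntitoneOn Φ'' (Ici 0) :=
    antitoneOn_of_hasDerivWithinAt_nonpos (convex_Ici 0)
      (fun x hx => (hd3 x hx).continuousWithinAt)
      (fun x hx => (hd3 x (interior_subset hx)).mono interior_subset)
      (fun x hx => h3 x (interior_subset hx))
  have hstrict : StrictConvexOn ℝ (Ici 0) Φ := by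
    refine StrictMonoOn.strictConvexOn_of_deriv (convex_Ici 0) hΦc
      ((hmono.mono interior_subset).congr fun x hx => ?_)
    rw [interior_Ici, mem_Ioi] at hx
    exact (hasDerivAt_of_hasDerivWithinAt_Ici hx (hd1 x hx.le)).deriv.symm
  have hlim := tendsto_twoPointEntropy_div (q := q) hd1 hd2 hmono hm (h2pos m hm.le).ne'
    hs0 hs1 hq1
  set L := q / (1 - q) * Φ'' m / (s / (1 - s) * Φ'' m)
  set g : ℝ → ℝ := fun v => twoPointEntropy Φ m q v / twoPointEntropy Φ m s v with hg
  set G : ℝ → ℝ := Function.update g m L with hG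
  have hGg : ∀ v, v ≠ m → G v = g v := fun v hv => Function.update_of_ne hv _ _
  have hms : m < m / s := by
    rw [lt_div_iff₀ hs0]
    nlinarith
  have hle : ∀ v ∈ Icc 0 (m / s), s * v ≤ m ∧ q * v ≤ m := by
    intro v hv
    have h := hv.2
    rw [le_div_iff₀ hs0] at h
    have := mul_le_mul_of_nonneg_right hqs hv.1
    constructor <;> linarith
  have hcont : ContinuousOn G (Icc 0 (m / s)) := by
    intro v hv
    rcases eq_or_ne v m with rfl | hne
    · exact (continuousAt_update_same.2 hlim).continuousWithinAt
    · refine ContinuousWithinAt.congr_of_eventuallyEq (f := g) ?_ ?_ (hGg v hne)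
      · exact ((continuousOn_twoPointEntropy hΦc hq1 fun v hv => ⟨hv.1, (hle v hv).2⟩) v hv).div
          ((continuousOn_twoPointEntropy hΦc hs1 fun v hv => ⟨hv.1, (hle v hv).1⟩) v hv)
          (twoPointEntropy_pos hstrict hs0 hs1 hv.1 (hle v hv).1 hne).ne'
      · filter_upwards [nhdsWithin_le_nhds (isOpen_ne.mem_nhds hne)] with x hx using hGg x hx
  have hderiv : ∀ v ∈ Ioo 0 (m / s), v ≠ m → ∃ g' ≤ 0, HasDerivAt G g' v := by
    intro v hv hne
    have hsv : s * v < m := by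
      have h := hv.2
      rw [lt_div_iff₀ hs0] at h
      linarith
    have hqv : q * v < m := (mul_le_mul_of_nonneg_right hqs hv.1.le).trans_lt hsv
    have hNpos := twoPointEntropy_pos hstrict hq0 hq1 hv.1.le hqv.le hne
    have hMpos := twoPointEntropy_pos hstrict hs0 hs1 hv.1.le hsv.le hne
    have hmon := twoPointEntropyDeriv_div_monotone hd1 hd2 hstrict hanti
      (fun x hx => (h2pos x hx).le) hF2 hq0 hqs hs1 hv.1 hsv hne
    rw [div_le_div_iff₀ hNpos hMpos] at hmon
    refine ⟨_, ?_, ((hasDerivAt_twoPointEntropy hd1 hq1 hv.1 hqv).div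
      (hasDerivAt_twoPointEntropy hd1 hs1 hv.1 hsv) hMpos.ne').congr_of_eventuallyEq ?_⟩
    · exact div_nonpos_of_nonpos_of_nonneg (by linarith) (sq_nonneg _)
    · filter_upwards [isOpen_ne.mem_nhds hne] with x hx using hGg x hx
  have hpiece : ∀ D : Set ℝ, Convex ℝ D → D ⊆ Icc 0 (m / s) → m ∉ interior D →
      AntitoneOn G D := by
    intro D hD hDsub hmD
    have hint : ∀ v ∈ interior D, ∃ g' ≤ 0, HasDerivAt G g' v := fun v hv =>
      hderiv v (by simpa using interior_mono hDsub hv) fun h => hmD (h ▸ hv)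
    refine antitoneOn_of_deriv_nonpos hD (hcont.mono hDsub) (fun v hv => ?_) (fun v hv => ?_)
    · obtain ⟨g', -, h⟩ := hint v hv
      exact h.differentiableAt.differentiableWithinAt
    · obtain ⟨g', h0, h⟩ := hint v hv
      rwa [h.deriv]
  have hanti' : AntitoneOn G (Icc 0 m ∪ Icc m (m / s)) :=
    (hpiece (Icc 0 m) (convex_Icc _ _) (Icc_subset_Icc_right hms.le) (by simp)).union_right
      (hpiece (Icc m (m / s)) (convex_Icc _ _) (Icc_subset_Icc_left hm.le) (by simp))
      (isGreatest_Icc hm.le) (isLeast_Icc hms.le)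
  rw [Icc_union_Icc_eq_Icc hm.le hms.le] at hanti'
  have hfinal := hanti' ⟨hv0, hvv'.le.trans hv'le⟩ ⟨hv0.trans hvv'.le, hv'le⟩ hvv'.le
  rwa [hGg v hvm, hGg v' hv'm] at hfinal
end

section
/- Let Φ be a three-times continuously differentiable function on [0,∞) with Φ'' ≥ 0 and Φ''' < 0 everywhere, satisfying x + Φ''(x)/Φ'''(x) ≥ y + 3·Φ''(y)/Φ'''(y) for all x,y ≥ 0. Then for all x,y ≥ 0: 3·Φ''(y)·(Φ'(x) − Φ'(y) + Φ''(x)·(y−x)) + Φ'''(y)·(Φ(x) − Φ(y) + Φ'(x)·(y−x) + Φ''(x)·(y−x)²) ≥ 0. -/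
/-- if `Φ` is three-times continuously differentiable on `[0,∞)` (with
derivatives `Φ'`, `Φ''`, `Φ'''`), `Φ'' ≥ 0` and `Φ''' < 0` everywhere on `[0,∞)`, and
`x + Φ''(x)/Φ'''(x) ≥ y + 3·Φ''(y)/Φ'''(y)` for all `x, y ≥ 0`, then for all `x, y ≥ 0`:
`3·Φ''(y)·(Φ'(x) − Φ'(y) + Φ''(x)·(y−x))
  + Φ'''(y)·(Φ(x) − Φ(y) + Φ'(x)·(y−x) + Φ''(x)·(y−x)²) ≥ 0`
(this quantity is `Q_x''(y)`). -/
theorem stmt12 (Φ Φ' Φ'' Φ''' : ℝ → ℝ)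
    (hd1 : ∀ x ∈ Set.Ici (0:ℝ), HasDerivWithinAt Φ (Φ' x) (Set.Ici 0) x)
    (hd2 : ∀ x ∈ Set.Ici (0:ℝ), HasDerivWithinAt Φ' (Φ'' x) (Set.Ici 0) x)
    (hd3 : ∀ x ∈ Set.Ici (0:ℝ), HasDerivWithinAt Φ'' (Φ''' x) (Set.Ici 0) x)
    (hcont : ContinuousOn Φ''' (Set.Ici 0))
    (h2nonneg : ∀ x ∈ Set.Ici (0:ℝ), 0 ≤ Φ'' x)
    (h3neg : ∀ x ∈ Set.Ici (0:ℝ), Φ''' x < 0)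
    (hF1 : ∀ x ∈ Set.Ici (0:ℝ), ∀ y ∈ Set.Ici (0:ℝ),
      x + Φ'' x / Φ''' x ≥ y + 3 * (Φ'' y / Φ''' y)) :
    ∀ x ∈ Set.Ici (0:ℝ), ∀ y ∈ Set.Ici (0:ℝ),
      3 * Φ'' y * (Φ' x - Φ' y + Φ'' x * (y - x)) +
          Φ''' y * (Φ x - Φ y + Φ' x * (y - x) + Φ'' x * (y - x) ^ 2) ≥ 0 := by
  intro x hx y hy
  set G : ℝ → ℝ := fun x => 3 * Φ'' y * (Φ' x - Φ' y + Φ'' x * (y - x)) +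
          Φ''' y * (Φ x - Φ y + Φ' x * (y - x) + Φ'' x * (y - x) ^ 2) with hG
  set g : ℝ → ℝ := fun x =>
    (y - x) * (3 * Φ'' y * Φ''' x + Φ''' y * (Φ''' x * (y - x) - Φ'' x)) with hg
  have hderiv : ∀ t ∈ Set.Ici (0:ℝ), HasDerivWithinAt G (g t) (Set.Ici 0) t := by
    intro t ht
    have h1 := hd1 t ht
    have h2 := hd2 t ht
    have h3 := hd3 t ht
    have h0 : HasDerivWithinAt (fun s : ℝ => y - s) (-1) (Set.Ici 0) t :=
      (hasDerivWithinAt_id t (Set.Ici 0)).const_sub y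
    have h := (((h2.sub_const (Φ' y)).add (h3.mul h0)).const_mul (3 * Φ'' y)).add
      ((((h1.sub_const (Φ y)).add (h2.mul h0)).add (h3.mul (h0.pow 2))).const_mul (Φ''' y))
    refine h.congr_deriv ?_
    simp only [hg, Pi.pow_apply]
    push_cast
    ring
  have hfactor : ∀ t ∈ Set.Ici (0:ℝ),
      3 * Φ'' y * Φ''' t + Φ''' y * (Φ''' t * (y - t) - Φ'' t) ≤ 0 := by
    intro t ht
    have hyt : Φ''' y < 0 := h3neg y hy
    have htt : Φ''' t < 0 := h3neg t ht
    have hle : y + 3 * (Φ'' y / Φ''' y) - (t + Φ'' t / Φ''' t) ≤ 0 :=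
      sub_nonpos.mpr (hF1 t ht y hy)
    have heq : 3 * Φ'' y * Φ''' t + Φ''' y * (Φ''' t * (y - t) - Φ'' t) =
        Φ''' y * Φ''' t * (y + 3 * (Φ'' y / Φ''' y) - (t + Φ'' t / Φ''' t)) := by
      field_simp [hyt.ne, htt.ne]
      ring
    rw [heq]
    exact mul_nonpos_of_nonneg_of_nonpos (mul_pos_of_neg_of_neg hyt htt).le hle
  have hGy : G y = 0 := by simp [hG]
  have hy0 : (0:ℝ) ≤ y := hy
  have hx0 : (0:ℝ) ≤ x := hx
  change 0 ≤ G x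
  rw [← hGy]
  rcases le_total x y with hxy | hxy
  · have hsub : Set.Icc 0 y ⊆ Set.Ici (0:ℝ) := Set.Icc_subset_Ici_self
    refine antitoneOn_of_hasDerivWithinAt_nonpos (f' := g) (convex_Icc 0 y)
      (fun t ht => (hderiv t (hsub ht)).continuousWithinAt.mono hsub)
      (fun t ht => (hderiv t (hsub (interior_subset ht))).mono (interior_subset.trans hsub))
      (fun t ht => ?_) ⟨hx0, hxy⟩ ⟨hy0, le_rfl⟩ hxy
    have ht' := interior_subset ht
    exact mul_nonpos_of_nonneg_of_nonpos (sub_nonneg.mpr ht'.2) (hfactor t (hsub ht'))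
  · have hsub : Set.Ici y ⊆ Set.Ici (0:ℝ) := Set.Ici_subset_Ici.mpr hy0
    refine monotoneOn_of_hasDerivWithinAt_nonneg (f' := g) (convex_Ici y)
      (fun t ht => (hderiv t (hsub ht)).continuousWithinAt.mono hsub)
      (fun t ht => (hderiv t (hsub (interior_subset ht))).mono (interior_subset.trans hsub))
      (fun t ht => ?_) Set.self_mem_Ici hxy hxy
    have ht' := interior_subset ht
    exact mul_nonneg_of_nonpos_of_nonpos (sub_nonpos.mpr ht') (hfactor t (hsub ht'))
end

section
/- Let Φ be a three-times differentiable convex function on [0,∞) with Φ''' ≤ 0 everywhere. Suppose x₁, m, x₂ ≥ 0 satisfy either x₂ < m < x₁ or x₁ < m < x₂. Then (Φ(x₂) + Φ'(x₂)(m−x₂) − Φ(m))·(Φ'(x₁) − Φ'(x₂)) + Φ''(x₂)·(m−x₂)²·((Φ(x₁)−Φ(m))/(x₁−m) + (Φ(x₂)−Φ(m))/(m−x₂)) ≥ (Φ(x₂) + Φ'(x₂)(m−x₂) − Φ(m))·(Φ'(m) − Φ'(x₂)) + Φ''(x₂)·(m−x₂)²·(Φ'(m) + (Φ(x₂)−Φ(m))/(m−x₂)).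 -/
/-- A function with nonnegative derivative on the interior of `[a, b] ⊆ [0, ∞)` does not decrease
from `a` to `b`. -/
theorem le_of_hasDerivWithinAt_Ici_nonneg {f f' : ℝ → ℝ}
    (hf : ∀ x ∈ Set.Ici (0:ℝ), HasDerivWithinAt f (f' x) (Set.Ici 0) x)
    {a b : ℝ} (ha : 0 ≤ a) (hab : a ≤ b) (h : ∀ x ∈ Set.Ioo a b, 0 ≤ f' x) : f a ≤ f b := by
  refine monotoneOn_of_deriv_nonneg (convex_Icc a b) ?_ ?_ ?_
    (Set.left_mem_Icc.2 hab) (Set.right_mem_Icc.2 hab) hab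
  · intro x hx
    exact (hf x (ha.trans hx.1)).continuousWithinAt.mono fun y hy => ha.trans hy.1
  all_goals
    intro x hx
    rw [interior_Icc] at hx
    have hx0 : 0 < x := ha.trans_lt hx.1
    have hd := (hf x hx0.le).hasDerivAt (Ici_mem_nhds hx0)
  · exact hd.differentiableAt.differentiableWithinAt
  · rw [hd.deriv]
    exact h x hx

/-- The increment of a concave function is at least the slope at the right endpoint times the
length. -/
theorem mul_sub_le_sub_of_antitoneOn {f' f'' : ℝ → ℝ}
    (hf' : ∀ x ∈ Set.Ici (0:ℝ), HasDerivWithinAt f' (f'' x) (Set.Ici 0) x)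
    (hanti : AntitoneOn f'' (Set.Ici 0))
    {a b : ℝ} (ha : 0 ≤ a) (hab : a ≤ b) :
    f'' b * (b - a) ≤ f' b - f' a := by
  have := le_of_hasDerivWithinAt_Ici_nonneg (f := fun x => f' x - f'' b * x)
    (fun x hx => (hf' x hx).sub ((hasDerivWithinAt_id x _).const_mul (f'' b))) ha hab
    fun x hx => by
      have := hanti (ha.trans hx.1.le) (ha.trans hab) hx.2.le
      linarith
  linarith

/-- The increment of a concave function is at most the slope at the left endpoint times the
length. -/
theorem sub_le_mul_sub_of_antitoneOn {f' f'' : ℝ → ℝ}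
    (hf' : ∀ x ∈ Set.Ici (0:ℝ), HasDerivWithinAt f' (f'' x) (Set.Ici 0) x)
    (hanti : AntitoneOn f'' (Set.Ici 0))
    {a b : ℝ} (ha : 0 ≤ a) (hab : a ≤ b) :
    f' b - f' a ≤ f'' a * (b - a) := by
  have := le_of_hasDerivWithinAt_Ici_nonneg (f := fun x => f'' a * x - f' x)
    (fun x hx => ((hasDerivWithinAt_id x _).const_mul (f'' a)).sub (hf' x hx)) ha hab
    fun x hx => by
      have := hanti ha (ha.trans hx.1.le) hx.1.le
      linarith
  linarith

/-- The trapezoid rule underestimates the integral of a concave function. -/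
theorem trapezoid_le_sub {f f' f'' : ℝ → ℝ}
    (hf : ∀ x ∈ Set.Ici (0:ℝ), HasDerivWithinAt f (f' x) (Set.Ici 0) x)
    (hf' : ∀ x ∈ Set.Ici (0:ℝ), HasDerivWithinAt f' (f'' x) (Set.Ici 0) x)
    (hanti : AntitoneOn f'' (Set.Ici 0))
    {a b : ℝ} (ha : 0 ≤ a) (hab : a ≤ b) :
    (f' a + f' b) / 2 * (b - a) ≤ f b - f a := by
  have := le_of_hasDerivWithinAt_Ici_nonneg (f := fun x => f x - (f' a + f' x) / 2 * (x - a))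
    (fun x hx => (hf x hx).sub ((((hf' x hx).const_add (f' a)).div_const 2).mul
      ((hasDerivWithinAt_id x _).sub_const a))) ha hab
    fun x hx => by
      have := mul_sub_le_sub_of_antitoneOn hf' hanti ha hx.1.le
      linarith
  linarith

/-- Upper bound on the first-order Taylor remainder at the left endpoint when the second
derivative is antitone. -/
theorem taylor_remainder_left_le {f f' f'' : ℝ → ℝ}
    (hf : ∀ x ∈ Set.Ici (0:ℝ), HasDerivWithinAt f (f' x) (Set.Ici 0) x)
    (hf' : ∀ x ∈ Set.Ici (0:ℝ), HasDerivWithinAt f' (f'' x) (Set.Ici 0) x)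
    (hanti : AntitoneOn f'' (Set.Ici 0))
    {a b : ℝ} (ha : 0 ≤ a) (hab : a ≤ b) :
    f b - f a - f' a * (b - a) ≤ f'' a * (b - a) ^ 2 / 2 := by
  have := le_of_hasDerivWithinAt_Ici_nonneg
    (f := fun x => f'' a * ((x - a) ^ 2 / 2) + f' a * x - f x)
    (fun x hx => (((((hasDerivWithinAt_id x _).sub_const a).pow 2).div_const 2).const_mul
      (f'' a)).add ((hasDerivWithinAt_id x _).const_mul (f' a)) |>.sub (hf x hx)) ha hab
    fun x hx => by
      have := sub_le_mul_sub_of_antitoneOn hf' hanti ha hx.1.le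
      norm_num
      linarith
  linarith

/-- Lower bound on the first-order Taylor remainder at the right endpoint when the second
derivative is antitone. -/
theorem le_taylor_remainder_right {f f' f'' : ℝ → ℝ}
    (hf : ∀ x ∈ Set.Ici (0:ℝ), HasDerivWithinAt f (f' x) (Set.Ici 0) x)
    (hf' : ∀ x ∈ Set.Ici (0:ℝ), HasDerivWithinAt f' (f'' x) (Set.Ici 0) x)
    (hanti : AntitoneOn f'' (Set.Ici 0))
    {a b : ℝ} (ha : 0 ≤ a) (hab : a ≤ b) :
    f'' b * (a - b) ^ 2 / 2 ≤ f a - f b - f' b * (a - b) := by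
  have := le_of_hasDerivWithinAt_Ici_nonneg
    (f := fun x => f'' b * ((x - b) ^ 2 / 2) + f' b * x - f x)
    (fun x hx => (((((hasDerivWithinAt_id x _).sub_const b).pow 2).div_const 2).const_mul
      (f'' b)).add ((hasDerivWithinAt_id x _).const_mul (f' b)) |>.sub (hf x hx)) ha hab
    fun x hx => by
      have := mul_sub_le_sub_of_antitoneOn hf' hanti (ha.trans hx.1.le) hx.2.le
      norm_num
      linarith
  linarith

/-- if `Φ` is a three-times differentiable convex function on `[0,∞)`
(with derivatives `Φ'`, `Φ''`, `Φ'''`) and `Φ''' ≤ 0` everywhere on `[0,∞)`, then for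
`x₁, m, x₂ ≥ 0` with either `x₂ < m < x₁` or `x₁ < m < x₂`, the function `w_{m,x₂}`
satisfies `w_{m,x₂}(x₁) ≥ w_{m,x₂}(m)`. -/
theorem stmt13 (Φ Φ' Φ'' Φ''' : ℝ → ℝ)
    (hd1 : ∀ x ∈ Set.Ici (0:ℝ), HasDerivWithinAt Φ (Φ' x) (Set.Ici 0) x)
    (hd2 : ∀ x ∈ Set.Ici (0:ℝ), HasDerivWithinAt Φ' (Φ'' x) (Set.Ici 0) x)
    (hd3 : ∀ x ∈ Set.Ici (0:ℝ), HasDerivWithinAt Φ'' (Φ''' x) (Set.Ici 0) x)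
    (hconv : ConvexOn ℝ (Set.Ici 0) Φ)
    (h3 : ∀ x ∈ Set.Ici (0:ℝ), Φ''' x ≤ 0)
    (x₁ m x₂ : ℝ) (hx₁ : 0 ≤ x₁) (hm : 0 ≤ m) (hx₂ : 0 ≤ x₂)
    (hcase : (x₂ < m ∧ m < x₁) ∨ (x₁ < m ∧ m < x₂)) :
    (Φ x₂ + Φ' x₂ * (m - x₂) - Φ m) * (Φ' x₁ - Φ' x₂) +
        Φ'' x₂ * (m - x₂) ^ 2 *
          ((Φ x₁ - Φ m) / (x₁ - m) + (Φ x₂ - Φ m) / (m - x₂)) ≥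
      (Φ x₂ + Φ' x₂ * (m - x₂) - Φ m) * (Φ' m - Φ' x₂) +
        Φ'' x₂ * (m - x₂) ^ 2 * (Φ' m + (Φ x₂ - Φ m) / (m - x₂)) := by
  have hanti : AntitoneOn Φ'' (Set.Ici 0) := fun a ha b _ hab => by
    have := le_of_hasDerivWithinAt_Ici_nonneg (fun x hx => (hd3 x hx).neg) ha hab
      fun x hx => neg_nonneg.2 (h3 x (le_trans ha hx.1.le))
    simpa using this
  have hU := uniqueDiffOn_Ici (0:ℝ)
  have hmono : MonotoneOn Φ' (Set.Ici 0) :=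
    (hconv.monotoneOn_derivWithin fun x hx => (hd1 x hx).differentiableWithinAt).congr
      fun x hx => (hd1 x hx).derivWithin (hU x hx)
  have hnonneg : 0 ≤ Φ'' x₂ := by
    rw [← (hd2 x₂ hx₂).derivWithin (hU x₂ hx₂)]
    exact hmono.derivWithin_nonneg
  suffices h : 0 ≤ (Φ x₂ + Φ' x₂ * (m - x₂) - Φ m) * (Φ' x₁ - Φ' m) +
      Φ'' x₂ * (m - x₂) ^ 2 * ((Φ x₁ - Φ m) / (x₁ - m) - Φ' m) by linarith
  have hq : 0 ≤ Φ'' x₂ * (m - x₂) ^ 2 := by positivity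
  have hslope : (Φ' x₁ - Φ' m) / 2 ≤ (Φ x₁ - Φ m) / (x₁ - m) - Φ' m := by
    rw [le_sub_iff_add_le]
    rcases hcase with ⟨-, h⟩ | ⟨h, -⟩
    · rw [le_div_iff₀ (sub_pos.2 h)]
      linarith [trapezoid_le_sub hd1 hd2 hanti hm h.le]
    · rw [← neg_div_neg_eq (Φ x₁ - Φ m), neg_sub, neg_sub, le_div_iff₀ (sub_pos.2 h)]
      linarith [trapezoid_le_sub hd1 hd2 hanti hx₁ h.le]
  have hprod : 0 ≤ (Φ x₂ + Φ' x₂ * (m - x₂) - Φ m + Φ'' x₂ * (m - x₂) ^ 2 / 2) *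
      (Φ' x₁ - Φ' m) := by
    rcases hcase with ⟨h, h'⟩ | ⟨h, h'⟩
    · exact mul_nonneg (by linarith [taylor_remainder_left_le hd1 hd2 hanti hx₂ h.le])
        (sub_nonneg.2 (hmono hm hx₁ h'.le))
    · exact mul_nonneg_of_nonpos_of_nonpos
        (by linarith [le_taylor_remainder_right hd1 hd2 hanti hm h'.le])
        (sub_nonpos.2 (hmono hx₁ hm h.le))
  linarith [mul_le_mul_of_nonneg_left hslope hq]
end

section
/- Let Φ ∈ 𝓕₂, i.e., Φ is a three-times differentiable convex function on [0,∞) with Φ''' ≤ 0 satisfying (Φ(x) + Φ'(x)(y−x) − Φ(y))·(Φ'(y) − Φ'(x)) + Φ''(x)·(y−x)²·(Φ'(y) − (Φ(x)−Φ(y))/(x−y)) ≥ 0 for all x,y ≥ 0 with x ≠ y. Suppose x₁, m, x₂ ≥ 0 satisfy either x₂ < m < x₁ or x₁ < m < x₂. Then (Φ(x₂) + Φ'(x₂)(m−x₂) − Φ(m))·(Φ'(x₁) − Φ'(x₂)) + Φ''(x₂)·(m−x₂)²·((Φ(x₁)−Φ(m))/(x₁−m) + (Φ(x₂)−Φ(m))/(m−x₂))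 ≥ 0. -/
open Set

lemma ConvexOn.monotoneOn_of_hasDerivWithinAt {s : Set ℝ} {f f' : ℝ → ℝ} (hf : ConvexOn ℝ s f)
    (hf' : ∀ x ∈ s, HasDerivWithinAt f (f' x) s x) : MonotoneOn f' s := by
  intro x hx y hy hxy
  rcases hxy.eq_or_lt with rfl | hlt
  · exact le_rfl
  · exact (hf.le_slope_of_hasDerivWithinAt hx hy hlt (hf' x hx)).trans
      (hf.slope_le_of_hasDerivWithinAt hx hy hlt (hf' y hy))

/-- A differentiable concave function lies below its tangent lines. -/
lemma ConcaveOn.le_tangent_of_hasDerivWithinAt {s : Set ℝ} {f : ℝ → ℝ} {f' x y : ℝ}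
    (hf : ConcaveOn ℝ s f) (hx : x ∈ s) (hy : y ∈ s) (hf' : HasDerivWithinAt f f' s x) :
    f y ≤ f x + f' * (y - x) := by
  rcases lt_trichotomy x y with h | rfl | h
  · have := hf.slope_le_of_hasDerivWithinAt hx hy h hf'
    rw [slope_def_field, div_le_iff₀ (sub_pos.2 h)] at this
    linarith
  · simp
  · have := hf.le_slope_of_hasDerivWithinAt hy hx h hf'
    rw [slope_def_field, le_div_iff₀ (sub_pos.2 h)] at this
    linarith

/-- If `f'` is concave, then `f` minus its second-order Taylor polynomial is antitone. -/
lemma antitoneOn_sub_taylor_of_concaveOn_deriv {s : Set ℝ} {f f' : ℝ → ℝ} {f'' a : ℝ}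
    (hf : ∀ x ∈ s, HasDerivWithinAt f (f' x) s x) (hf' : HasDerivWithinAt f' f'' s a)
    (hc : ConcaveOn ℝ s f') (ha : a ∈ s) :
    AntitoneOn (fun u ↦ f u - f' a * (u - a) - f'' * (u - a) ^ 2 / 2) s := by
  have hd : ∀ u ∈ s, HasDerivWithinAt (fun u ↦ f u - f' a * (u - a) - f'' * (u - a) ^ 2 / 2)
      (f' u - f' a - f'' * (u - a)) s u := fun u hu ↦ by
    have h1 := (hasDerivWithinAt_id u s).sub_const a
    refine (((hf u hu).sub (h1.const_mul (f' a))).sub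
      (((h1.pow 2).const_mul f'').div_const 2)).congr_deriv ?_
    simp only [id_eq, Nat.cast_ofNat]
    ring
  refine antitoneOn_of_hasDerivWithinAt_nonpos hc.1 (fun u hu ↦ (hd u hu).continuousWithinAt)
    (fun u hu ↦ (hd u (interior_subset hu)).mono interior_subset) fun u hu ↦ ?_
  have := hc.le_tangent_of_hasDerivWithinAt ha (interior_subset hu) hf'
  linarith

/-- The trapezoid rule underestimates the increments of a function with concave derivative. -/
lemma monotoneOn_sub_trapezoid_of_concaveOn_deriv {s : Set ℝ} {f f' f'' : ℝ → ℝ} {p : ℝ}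
    (hf : ∀ x ∈ s, HasDerivWithinAt f (f' x) s x)
    (hf' : ∀ x ∈ s, HasDerivWithinAt f' (f'' x) s x)
    (hc : ConcaveOn ℝ s f') (hp : p ∈ s) :
    MonotoneOn (fun u ↦ f u - (u - p) * (f' p + f' u) / 2) s := by
  have hd : ∀ u ∈ s, HasDerivWithinAt (fun u ↦ f u - (u - p) * (f' p + f' u) / 2)
      (f' u - (1 * (f' p + f' u) + (u - p) * f'' u) / 2) s u := fun u hu ↦
    (hf u hu).sub ((((hasDerivWithinAt_id u s).sub_const p).mul
      ((hf' u hu).const_add (f' p))).div_const 2)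
  refine monotoneOn_of_hasDerivWithinAt_nonneg hc.1 (fun u hu ↦ (hd u hu).continuousWithinAt)
    (fun u hu ↦ (hd u (interior_subset hu)).mono interior_subset) fun u hu ↦ ?_
  have := hc.le_tangent_of_hasDerivWithinAt (interior_subset hu) hp (hf' u (interior_subset hu))
  linarith


/-- if `Φ ∈ 𝓕₂`, i.e. `Φ` is a three-times differentiable convex function
on `[0,∞)` (with derivatives `Φ'`, `Φ''`, `Φ'''`), `Φ''' ≤ 0`, and
`(Φ(x) + Φ'(x)(y−x) − Φ(y))·(Φ'(y) − Φ'(x))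
  + Φ''(x)·(y−x)²·(Φ'(y) − (Φ(x)−Φ(y))/(x−y)) ≥ 0` for all `x, y ≥ 0` with `x ≠ y`,
then for `x₁, m, x₂ ≥ 0` with either `x₂ < m < x₁` or `x₁ < m < x₂`,
`w_{m,x₂}(x₁) ≥ 0`. -/
theorem stmt14 (Φ Φ' Φ'' Φ''' : ℝ → ℝ)
    (hd1 : ∀ x ∈ Set.Ici (0:ℝ), HasDerivWithinAt Φ (Φ' x) (Set.Ici 0) x)
    (hd2 : ∀ x ∈ Set.Ici (0:ℝ), HasDerivWithinAt Φ' (Φ'' x) (Set.Ici 0) x)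
    (hd3 : ∀ x ∈ Set.Ici (0:ℝ), HasDerivWithinAt Φ'' (Φ''' x) (Set.Ici 0) x)
    (hconv : ConvexOn ℝ (Set.Ici 0) Φ)
    (h3 : ∀ x ∈ Set.Ici (0:ℝ), Φ''' x ≤ 0)
    (hF2 : ∀ x ∈ Set.Ici (0:ℝ), ∀ y ∈ Set.Ici (0:ℝ), x ≠ y →
      (Φ x + Φ' x * (y - x) - Φ y) * (Φ' y - Φ' x) +
          Φ'' x * (y - x) ^ 2 * (Φ' y - (Φ x - Φ y) / (x - y)) ≥ 0)
    (x₁ m x₂ : ℝ) (hx₁ : 0 ≤ x₁) (hm : 0 ≤ m) (hx₂ : 0 ≤ x₂)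
    (hcase : (x₂ < m ∧ m < x₁) ∨ (x₁ < m ∧ m < x₂)) :
    (Φ x₂ + Φ' x₂ * (m - x₂) - Φ m) * (Φ' x₁ - Φ' x₂) +
        Φ'' x₂ * (m - x₂) ^ 2 *
          ((Φ x₁ - Φ m) / (x₁ - m) + (Φ x₂ - Φ m) / (m - x₂)) ≥ 0 := by
  have hmono : MonotoneOn Φ' (Ici 0) := hconv.monotoneOn_of_hasDerivWithinAt hd1
  have hconc : ConcaveOn ℝ (Ici 0) Φ' :=
    concaveOn_of_hasDerivWithinAt2_nonpos (convex_Ici 0)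
      (fun x hx ↦ (hd2 x hx).continuousWithinAt)
      (fun x hx ↦ (hd2 x (interior_subset hx)).mono interior_subset)
      (fun x hx ↦ (hd3 x (interior_subset hx)).mono interior_subset)
      (fun x hx ↦ h3 x (interior_subset hx))
  have hnonneg : 0 ≤ Φ'' x₂ := by
    rw [← (hd2 x₂ hx₂).derivWithin (uniqueDiffOn_Ici 0 x₂ hx₂)]
    exact hmono.derivWithin_nonneg
  have htaylor := antitoneOn_sub_taylor_of_concaveOn_deriv hd1 (hd2 x₂ hx₂) hconc hx₂
  have htrap : ∀ p ∈ Ici (0 : ℝ), _ := fun p hp ↦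
    monotoneOn_sub_trapezoid_of_concaveOn_deriv hd1 hd2 hconc hp
  have hK : 0 ≤ Φ'' x₂ * (m - x₂) ^ 2 := by positivity
  have hsecant : (Φ x₂ - Φ m) / (m - x₂) = -((Φ x₂ - Φ m) / (x₂ - m)) := by
    rw [← div_neg, neg_sub]
  have hslope : (Φ' x₁ - Φ' m) / 2 ≤ (Φ x₁ - Φ m) / (x₁ - m) - Φ' m := by
    rcases hcase with ⟨-, h⟩ | ⟨h, -⟩
    · have := htrap m hm hm hx₁ h.le
      simp only at this
      rw [le_sub_iff_add_le, le_div_iff₀ (by linarith)]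
      linarith
    · have := htrap x₁ hx₁ hx₁ hm h.le
      simp only at this
      rw [le_sub_iff_add_le, le_div_iff_of_neg (by linarith)]
      linarith
  have hprod : 0 ≤ (Φ x₂ + Φ' x₂ * (m - x₂) - Φ m + Φ'' x₂ * (m - x₂) ^ 2 / 2) *
      (Φ' x₁ - Φ' m) := by
    rcases hcase with ⟨h, h'⟩ | ⟨h', h⟩
    · have := htaylor hx₂ hm h.le
      simp only [sub_self] at this
      exact mul_nonneg (by linarith) (sub_nonneg.2 (hmono hm hx₁ h'.le))
    · have := htaylor hm hx₂ h.le
      simp only [sub_self] at this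
      exact mul_nonneg_of_nonpos_of_nonpos (by linarith) (sub_nonpos.2 (hmono hx₁ hm h'.le))
  have hbase := hF2 x₂ hx₂ m hm (by rcases hcase with ⟨h, -⟩ | ⟨-, h⟩; exacts [h.ne, h.ne'])
  have hstep := mul_le_mul_of_nonneg_left hslope hK
  rw [hsecant]
  linarith
end

section
/- Let Φ ∈ 𝓕 with domain I. Let (A,B,W) be jointly distributed finite-valued random variables and let (λ₁,λ₂) be a pair of real numbers such that for every value w of W with P(W=w) > 0, the pair (λ₁,λ₂) belongs to the Φ-ribbon of the conditional joint distribution of (A,B) given W = w. Then for every function f of (A,B,W) with values in I: λ₁·H_Φ(E[f|A,W] | W) + λ₂·H_Φ(E[f|B,W] | W) ≤ H_Φ(f | W). -/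
open Finset

/-- The conditional Φ-entropy given the last coordinate is the average of the Φ-entropies
under the conditional distributions. -/
lemma condEntPhi_snd_snd_eq_sum {α β γ : Type*} [Fintype α] [Fintype β] [Fintype γ]
    [DecidableEq γ] (Φ : ℝ → ℝ) (μ : α × β × γ → ℝ) (hμ : ∀ ω, 0 ≤ μ ω)
    (g : α × β × γ → ℝ) :
    condEntPhi Φ μ g (fun ω => ω.2.2) =
      ∑ w, (∑ a, ∑ b, μ (a, b, w)) *
        entPhi Φ (fun ab : α × β => μ (ab.1, ab.2, w) / ∑ a, ∑ b, μ (a, b, w))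
          (fun ab => g (ab.1, ab.2, w)) := by
  have sum_eq (h : α × β × γ → ℝ) : ∑ ω, h ω = ∑ w, ∑ a, ∑ b, h (a, b, w) := by
    simp only [Fintype.sum_prod_type]
    rw [Finset.sum_comm]
    simp_rw [Finset.sum_comm (s := (Finset.univ : Finset γ))]
    rw [Finset.sum_comm]
  have cond_eq (h : α × β × γ → ℝ) (w : γ) :
      (∑ ω, if ω.2.2 = w then h ω else 0) = ∑ a, ∑ b, h (a, b, w) := by
    simp [Fintype.sum_prod_type]
  unfold condEntPhi pexp
  rw [sum_eq, sum_eq, ← Finset.sum_sub_distrib]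
  refine Finset.sum_congr rfl fun w _ => ?_
  simp only [pcexp, cond_eq, entPhi, pexp, Fintype.sum_prod_type]
  by_cases hm : (∑ a, ∑ b, μ (a, b, w)) = 0
  · have h0 : ∀ a b, μ (a, b, w) = 0 := by
      intro a b
      have ha := (Finset.sum_eq_zero_iff_of_nonneg
        fun a _ => Finset.sum_nonneg fun b _ => hμ (a, b, w)).1 hm a (Finset.mem_univ a)
      exact (Finset.sum_eq_zero_iff_of_nonneg fun b _ => hμ (a, b, w)).1 ha b
        (Finset.mem_univ b)
    simp [h0]
  · simp only [div_mul_eq_mul_div, ← Finset.sum_div, ← Finset.sum_mul]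
    field_simp

/-- Conditioning on a random variable together with the last coordinate amounts to conditioning
on that random variable under the conditional distribution. -/
lemma pcexp_prodMk_snd_snd {α β γ δ : Type*} [Fintype α] [Fintype β] [Fintype γ]
    [DecidableEq γ] [DecidableEq δ] (μ : α × β × γ → ℝ) (X : α × β → δ)
    (f : α × β × γ → ℝ) (w : γ) (hw : (∑ a, ∑ b, μ (a, b, w)) ≠ 0) (ab : α × β) :
    pcexp μ (fun ω => (X (ω.1, ω.2.1), ω.2.2)) f (ab.1, ab.2, w) =
      pcexp (fun ab : α × β => μ (ab.1, ab.2, w) / ∑ a, ∑ b, μ (a, b, w)) X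
        (fun ab => f (ab.1, ab.2, w)) ab := by
  have cond_eq (h : α × β × γ → ℝ) :
      (∑ ω : α × β × γ, if (X (ω.1, ω.2.1), ω.2.2) = (X ab, w) then h ω else 0) =
        ∑ ab' : α × β, if X ab' = X ab then h (ab'.1, ab'.2, w) else 0 := by
    simp [Fintype.sum_prod_type, ite_and, Finset.sum_ite_irrel]
  have div_eq (h : α × β → ℝ) (m : ℝ) :
      (∑ ab', if X ab' = X ab then h ab' / m else 0) =
        (∑ ab', if X ab' = X ab then h ab' else 0) / m := by
    rw [Finset.sum_div]
    exact Finset.sum_congr rfl fun _ _ => by split_ifs <;> simp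
  simp only [pcexp, Prod.mk.eta, cond_eq, div_mul_eq_mul_div, div_eq]
  rw [div_div_div_cancel_right₀ hw]

/-- conditional version of the Φ-ribbon inequality: if `(λ₁,λ₂)` lies
in the Φ-ribbon of the conditional distribution of `(A,B)` given `W = w` for every `w`
with `P(W=w) > 0`, then for every `I`-valued function `f` of `(A,B,W)`:
`λ₁·H_Φ(E[f|A,W] | W) + λ₂·H_Φ(E[f|B,W] | W) ≤ H_Φ(f | W)`.
The sample space is `α × β × γ`, a point `ω = (a, b, w)`. -/
theorem stmt17 (P : PhiFamily)
    {α β γ : Type*} [Fintype α] [Fintype β] [Fintype γ]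
    [DecidableEq α] [DecidableEq β] [DecidableEq γ]
    (μ : α × β × γ → ℝ) (hμ : IsPMF μ) (l : ℝ × ℝ)
    (hl : ∀ w : γ, 0 < (∑ a, ∑ b, μ (a, b, w)) →
      l ∈ ribbon P (fun ab : α × β => μ (ab.1, ab.2, w) / ∑ a, ∑ b, μ (a, b, w)))
    (f : α × β × γ → ℝ) (hf : ∀ ω, f ω ∈ P.I) :
    l.1 * condEntPhi P.Φ μ (pcexp μ (fun ω => (ω.1, ω.2.2)) f) (fun ω => ω.2.2) +
        l.2 * condEntPhi P.Φ μ (pcexp μ (fun ω => (ω.2.1, ω.2.2)) f) (fun ω => ω.2.2) ≤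
      condEntPhi P.Φ μ f (fun ω => ω.2.2) := by
  simp only [condEntPhi_snd_snd_eq_sum P.Φ μ hμ.1, Finset.mul_sum, ← Finset.sum_add_distrib]
  refine Finset.sum_le_sum fun w _ => ?_
  have hnn : 0 ≤ ∑ a, ∑ b, μ (a, b, w) :=
    Finset.sum_nonneg fun a _ => Finset.sum_nonneg fun b _ => hμ.1 (a, b, w)
  rcases hnn.eq_or_lt with hm | hm
  · simp [← hm]
  · have hA := funext (pcexp_prodMk_snd_snd μ Prod.fst f w hm.ne')
    have hB := funext (pcexp_prodMk_snd_snd μ Prod.snd f w hm.ne')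
    rw [hA, hB]
    have key := mul_le_mul_of_nonneg_left
      (hl w hm (fun ab => f (ab.1, ab.2, w)) fun ab => hf _) hnn
    linarith
end
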